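/- Let A ∈ ℝ_max^{n×n} with λ(A) = 0, g = g(C(A)) ≥ 2, T_1(A) = DM(g,n), and not n = g = 2; assume C(A) is strongly connected with a unique critical cycle Z_0 of length g up to choice of its first node. Then D(A) has a unique Hamiltonian cycle of maximal weight up to choice of its first node, and under the renumbering of nodes for which the interesting walk equals (g+1)⋯n(1⋯n)^g, this Hamiltonian cycle is 1 2 ⋯ n 1. -/

import Mathlib

open scoped Classical

noncomputable section

/-- The max-plus semiring carrier: `ℝ ∪ {-∞}`. `max` is the semiring addition `⊕`
and `+` (with `⊥` absorbing) is the semiring multiplication `⊗`. -/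
abbrev Rmax : Type := WithBot ℝ

/-- Square max-plus matrices. -/
abbrev Mat (n : ℕ) : Type := Fin n → Fin n → Rmax

namespace MaxPlus

variable {n : ℕ}

/-- Entrywise max-plus sum of matrices. -/
def oplus (A B : Mat n) : Mat n := fun i j => max (A i j) (B i j)

/-- Max-plus matrix product. -/
def mul (A B : Mat n) : Mat n := fun i j => Finset.univ.sup fun k => A i k + B k j

/-- Max-plus identity matrix. -/
def idm : Mat n := fun i j => if i = j then 0 else ⊥

/-- Max-plus matrix power. -/
def pow (A : Mat n) : ℕ → Mat n
  | 0 => idm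
  | t + 1 => mul A (pow A t)

/-- The arc relation of the digraph `D(A)`. -/
def arc (A : Mat n) (i j : Fin n) : Prop := A i j ≠ ⊥

/-- `W` is a walk of the digraph with arc relation `R` (a nonempty list of nodes,
consecutive nodes joined by arcs). -/
def IsWalk (R : Fin n → Fin n → Prop) (W : List (Fin n)) : Prop := W ≠ [] ∧ W.Chain' R

/-- `W` is a walk from `i` to `j`. -/
def IsWalkFrom (R : Fin n → Fin n → Prop) (W : List (Fin n)) (i j : Fin n) : Prop :=
  IsWalk R W ∧ W.head? = some i ∧ W.getLast? = some j

/-- The length of a walk: its number of arcs (= number of nodes minus one). -/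
def len (W : List (Fin n)) : ℕ := W.length - 1

/-- The weight `p(W)` of a walk: the max-plus product (= sum) of its arc weights. -/
def weight (A : Mat n) (W : List (Fin n)) : Rmax :=
  ((W.zip W.tail).map fun p => A p.1 p.2).sum

/-- A cycle: a closed walk of positive length with no proper closed subwalk. -/
def IsCycle (R : Fin n → Fin n → Prop) (W : List (Fin n)) : Prop :=
  2 ≤ W.length ∧ W.Chain' R ∧ W.head? = W.getLast? ∧ W.dropLast.Nodup

/-- The mean weight of a cycle: its weight divided by its length. -/
def mean (A : Mat n) (W : List (Fin n)) : Rmax :=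
  (weight A W).map fun r => r / (len W : ℝ)

/-- The maximum cycle mean `λ(A)` (equal to `⊥ = -∞` if there are no cycles). -/
def lam (A : Mat n) : Rmax := sSup {m | ∃ W, IsCycle (arc A) W ∧ m = mean A W}

/-- A critical cycle: a cycle of `D(A)` attaining the maximum cycle mean. -/
def IsCritCycle (A : Mat n) (W : List (Fin n)) : Prop :=
  IsCycle (arc A) W ∧ mean A W = lam A

/-- A node of the critical graph `C(A)`. -/
def critNode (A : Mat n) (i : Fin n) : Prop := ∃ W, IsCritCycle A W ∧ i ∈ W

/-- An arc of the critical graph `C(A)`. -/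
def critArc (A : Mat n) (i j : Fin n) : Prop :=
  ∃ W, IsCritCycle A W ∧ (i, j) ∈ W.zip W.tail

/-- Reachability in the digraph with arc relation `R`. -/
def reach (R : Fin n → Fin n → Prop) (i j : Fin n) : Prop := ∃ W, IsWalkFrom R W i j

/-- `i` and `j` lie in the same strongly connected component. -/
def sameSCC (R : Fin n → Fin n → Prop) (i j : Fin n) : Prop := reach R i j ∧ reach R j i

/-- `i` lies on some cycle of the digraph. -/
def onCycle (R : Fin n → Fin n → Prop) (i : Fin n) : Prop := ∃ W, IsCycle R W ∧ i ∈ W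

/-- The girth of the strongly connected component of `i`: the minimal length of a
cycle meeting that component. -/
def girthAt (R : Fin n → Fin n → Prop) (i : Fin n) : ℕ :=
  sInf {t | ∃ W, IsCycle R W ∧ (∃ v ∈ W, sameSCC R i v) ∧ len W = t}

/-- The maximal girth of a (completely reducible) digraph: the maximum of the girths
of its strongly connected components. -/
def maxGirth (R : Fin n → Fin n → Prop) : ℕ :=
  sSup {g | ∃ i, onCycle R i ∧ girthAt R i = g}

/-- The gcd of the cycle lengths in the strongly connected component of `i`
(described as the greatest common divisor of all such cycle lengths). -/
def sccGcd (R : Fin n → Fin n → Prop) (i : Fin n) : ℕ :=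
  sSup {d | ∀ W, IsCycle R W → (∃ v ∈ W, sameSCC R i v) → d ∣ len W}

/-- The cyclicity of a (completely reducible) digraph: the lcm over its strongly
connected components of the gcds of their cycle lengths. -/
def cyclicity (R : Fin n → Fin n → Prop) : ℕ :=
  (Finset.univ.filter fun i => onCycle R i).lcm (sccGcd R)

/-- Kleene star `X^* = I ⊕ X ⊕ ⋯ ⊕ X^{n-1}`. -/
def star (A : Mat n) : Mat n := fun i j => (Finset.range n).sup fun k => pow A k i j

/-- Scalar (max-plus) multiplication of a matrix. -/
def smul (c : Rmax) (A : Mat n) : Mat n := fun i j => c + A i j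

/-- Max-plus negation (inversion) of a scalar. -/
def negB : Rmax → Rmax := WithBot.map Neg.neg

/-- The CSR term `CS^tR[A]`. -/
def csr (A : Mat n) (t : ℕ) : Mat n :=
  if lam A = ⊥ then fun _ _ => ⊥ else
    let M := star (pow (smul (negB (lam A)) A) (cyclicity (critArc A)))
    let C : Mat n := fun i j => if critNode A j then M i j else ⊥
    let S : Mat n := fun i j => if critArc A i j then A i j else ⊥
    let R : Mat n := fun i j => if critNode A i then M i j else ⊥
    mul C (mul (pow S t) R)

/-- The Nachtigall matrix `B_N`: entries with a critical index are set to `-∞`. -/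
def bN (A : Mat n) : Mat n := fun i j => if critNode A i ∨ critNode A j then ⊥ else A i j

/-- The weak CSR threshold `T₁(A) = T₁(A, B_N)`. -/
def T1 (A : Mat n) : ℕ :=
  sInf {T | ∀ t, T ≤ t → pow A t = oplus (csr A t) (pow (bN A) t)}

/-- The Dulmage–Mendelsohn bound `DM(g,n) = g(n-2) + n`. -/
def DM (g N : ℕ) : ℕ := g * (N - 2) + N

/-- The Wielandt bound `Wi(n)`. -/
def Wi (N : ℕ) : ℕ := if N = 1 then 0 else (N - 1) ^ 2 + 1

/-- The matrix `A₁` (0-indexed version of Equation (5) of the paper): it keeps the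
arcs `(i,i+1)` for `1 ≤ i ≤ n-1`, `(n,1)` and `(g,1)` of `A` (in 1-indexed terms). -/
def A1 (A : Mat n) (g : ℕ) : Mat n := fun i j =>
  if j.val = i.val + 1 ∨ (i.val = n - 1 ∧ j.val = 0) ∨ (i.val = g - 1 ∧ j.val = 0)
  then A i j else ⊥

/-- The matrix `B₁`: it keeps the arcs `(i,j)` with `i > g`, `j > g`,
`j ≡ i+1 (mod g)` (in 1-indexed terms). -/
def B1 (A : Mat n) (g : ℕ) : Mat n := fun i j =>
  if g ≤ i.val ∧ g ≤ j.val ∧ j.val % g = (i.val + 1) % g then A i j else ⊥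

/-- The matrix `A₂`: the remaining entries of `A`. -/
def A2 (A : Mat n) (g : ℕ) : Mat n := fun i j =>
  if oplus (A1 A g) (B1 A g) i j ≠ ⊥ then ⊥ else A i j

/-- Strict domination of matrices: `X < Y` entrywise, equality allowed only at `-∞`. -/
def mLt (X Y : Mat n) : Prop := ∀ i j, X i j < Y i j ∨ (X i j = ⊥ ∧ Y i j = ⊥)

/-- The cycle `1 2 ⋯ g 1` (0-indexed: the node list `[0,1,…,g-1,0]`). -/
def stdCyc (N g : ℕ) : List (Fin N) := (List.finRange N).take g ++ (List.finRange N).take 1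

/-- The node list of the walk `(g+1)⋯n(1⋯n)^g` (0-indexed). -/
def wInteresting (N g : ℕ) : List (Fin N) :=
  (List.finRange N).drop g ++ (List.replicate g (List.finRange N)).flatten

/-- The node list of the walk `n(1⋯(n-1))^{n-1}1⋯n` (0-indexed). -/
def wWielandt (N : ℕ) : List (Fin N) :=
  (List.finRange N).drop (N - 1) ++
    (List.replicate (N - 1) ((List.finRange N).take (N - 1))).flatten ++ List.finRange N

/-- Walks from `i` to `j` through a node of `Z₀` whose length is `≡ m (mod γ)`. -/
def ThroughSet (A : Mat n) (Z0 : List (Fin n)) (i j : Fin n) (γ m : ℕ) :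
    Set (List (Fin n)) :=
  {V | IsWalkFrom (arc A) V i j ∧ (∃ v ∈ V, v ∈ Z0) ∧ len V % γ = m % γ}

/-- A twice optimal walk: of minimal length among the walks of maximal weight in
`ThroughSet A Z0 i j γ m`. -/
def TwiceOpt (A : Mat n) (Z0 : List (Fin n)) (i j : Fin n) (γ m : ℕ)
    (W : List (Fin n)) : Prop :=
  W ∈ ThroughSet A Z0 i j γ m ∧
  (∀ V ∈ ThroughSet A Z0 i j γ m, weight A V ≤ weight A W) ∧
  (∀ V ∈ ThroughSet A Z0 i j γ m, weight A V = weight A W → len W ≤ len V)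

/-- An interesting walk: twice optimal (for residue `DM(g,n) - 1` modulo `g`) of
length `DM(g,n) + g - 1`. -/
def Interesting (A : Mat n) (g : ℕ) (Z0 : List (Fin n)) (i j : Fin n)
    (W : List (Fin n)) : Prop :=
  TwiceOpt A Z0 i j g (DM g n - 1) W ∧ len W = DM g n + g - 1

/-- The index of a digraph: the transient of its Boolean adjacency matrix. -/
def Tind (R : Fin n → Fin n → Prop) : ℕ :=
  sInf {T | ∀ t, T ≤ t → ∀ i j : Fin n,
    (∃ W, IsWalkFrom R W i j ∧ len W = t) ↔
      (∃ W, IsWalkFrom R W i j ∧ len W = t + cyclicity R)}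

/-- The transient of row `i` of `A`. -/
def rowTrans (A : Mat n) (i : Fin n) : ℕ :=
  sInf {T | ∀ t, T ≤ t → ∀ j, pow A t i j = csr A t i j}

/-- The transient of column `i` of `A`. -/
def colTrans (A : Mat n) (i : Fin n) : ℕ :=
  sInf {T | ∀ t, T ≤ t → ∀ j, pow A t j i = csr A t j i}

/-- The maximum of the transients of the critical rows and columns of `A`. -/
def critTransMax (A : Mat n) : ℕ :=
  (Finset.univ.filter fun i => critNode A i).sup fun i =>
    max (rowTrans A i) (colTrans A i)

/-- Renumbering of the nodes of `A` by a permutation `σ`. -/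
def renum (σ : Equiv.Perm (Fin n)) (A : Mat n) : Mat n := fun i j => A (σ i) (σ j)

end MaxPlus

namespace MaxPlus

section

/-- There is a walk from `i` to `j` of length `ℓ` and finite weight `w`. -/
inductive Reach {n : ℕ} (A : Mat n) : Fin n → Fin n → ℕ → ℝ → Prop
  | nil (i : Fin n) : Reach A i i 0 0
  | cons {i k j : Fin n} {a : ℝ} {ℓ : ℕ} {w : ℝ} (h : A i k = (a : Rmax))
      (h' : Reach A k j ℓ w) : Reach A i j (ℓ + 1) (a + w)

/-- `x` is a walk of length `L` whose initial pieces have weights `c k - c 0`. -/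
def Traj {n : ℕ} (A : Mat n) (x : ℕ → Fin n) (c : ℕ → ℝ) (L : ℕ) : Prop :=
  ∀ k < L, A (x k) (x (k + 1)) = ((c (k + 1) - c k : ℝ) : Rmax)

variable {n : ℕ} {A B : Mat n}

namespace Reach

theorem cast {i j : Fin n} {ℓ ℓ' : ℕ} {w w' : ℝ} (h : Reach A i j ℓ w) (hℓ : ℓ = ℓ')
    (hw : w = w') : Reach A i j ℓ' w' := hℓ ▸ hw ▸ h

theorem single {i j : Fin n} {a : ℝ} (h : A i j = (a : Rmax)) : Reach A i j 1 a :=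
  (Reach.cons h (Reach.nil j)).cast (by omega) (by ring)

theorem trans {i j k : Fin n} {ℓ ℓ' : ℕ} {w w' : ℝ} (h : Reach A i j ℓ w)
    (h' : Reach A j k ℓ' w') : Reach A i k (ℓ + ℓ') (w + w') := by
  induction h with
  | nil i => exact h'.cast (by omega) (by ring)
  | cons ha _ ih => exact (Reach.cons ha (ih h')).cast (by omega) (by ring)

theorem mono {i j : Fin n} {ℓ : ℕ} {w : ℝ} (hBA : ∀ i j, B i j ≠ ⊥ → A i j = B i j)
    (h : Reach B i j ℓ w) : Reach A i j ℓ w := by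
  induction h with
  | nil i => exact .nil i
  | cons ha _ ih => exact .cons ((hBA _ _ (by rw [ha]; exact WithBot.coe_ne_bot)).trans ha) ih

theorem eq_of_zero {i j : Fin n} {w : ℝ} (h : Reach A i j 0 w) : i = j ∧ w = 0 := by
  cases h; exact ⟨rfl, rfl⟩

theorem repeat_closed {i : Fin n} {ℓ : ℕ} (h : Reach A i i ℓ 0) (K : ℕ) :
    Reach A i i (ℓ * K) 0 := by
  induction K with
  | zero => exact .nil i
  | succ K ih => exact (ih.trans h).cast (by ring) (by ring)

theorem exists_traj {i j : Fin n} {ℓ : ℕ} {w : ℝ} (h : Reach A i j ℓ w) :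
    ∃ x c, Traj A x c ℓ ∧ x 0 = i ∧ x ℓ = j ∧ c 0 = 0 ∧ c ℓ = w := by
  induction h with
  | nil i => exact ⟨fun _ => i, fun _ => 0, fun k hk => absurd hk (by omega), rfl, rfl, rfl, rfl⟩
  | @cons i k j a ℓ w ha _ ih =>
    obtain ⟨x, c, hx, h0, h1, c0, c1⟩ := ih
    refine ⟨fun m => Nat.casesOn m i x, fun m => Nat.casesOn m 0 (fun m => a + c m), ?_, rfl, h1,
      rfl, by simp [c1]⟩
    rintro (_ | m) hm
    · simpa [h0, c0] using ha
    · have := hx m (by omega)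
      simp only [this]
      congr 1
      ring

end Reach

namespace Traj

variable {x : ℕ → Fin n} {c : ℕ → ℝ} {L : ℕ}

theorem seg (h : Traj A x c L) {a b : ℕ} (hab : a ≤ b) (hb : b ≤ L) :
    Reach A (x a) (x b) (b - a) (c b - c a) := by
  induction b, hab using Nat.le_induction with
  | base => exact (Reach.nil _).cast (by omega) (by ring)
  | succ b hab ih =>
    exact ((ih (by omega)).trans (.single (h b (by omega)))).cast (by omega) (by ring)

theorem mono (h : Traj A x c L) {L' : ℕ} (hL : L' ≤ L) : Traj A x c L' :=
  fun k hk => h k (by omega)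

theorem shift (h : Traj A x c L) (a : ℕ) {L' : ℕ} (ha : a + L' ≤ L) :
    Traj A (fun k => x (a + k)) (fun k => c (a + k)) L' :=
  fun k hk => h (a + k) (by omega)

end Traj

theorem weight_singleton (v : Fin n) : weight A [v] = 0 := by simp [weight]

theorem weight_cons_cons (u v : Fin n) (l : List (Fin n)) :
    weight A (u :: v :: l) = A u v + weight A (v :: l) := by simp [weight]

theorem weight_append (a : List (Fin n)) (v : Fin n) (b : List (Fin n)) :
    weight A (a ++ v :: b) = weight A (a ++ [v]) + weight A (v :: b) := by
  induction a with
  | nil => simp [weight_singleton]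
  | cons u a ih =>
    cases a with
    | nil => simp [weight_cons_cons, weight_singleton]
    | cons u' a =>
      simp only [List.cons_append, weight_cons_cons] at ih ⊢
      rw [ih, add_assoc]

theorem chain_iff_weight_ne_bot (W : List (Fin n)) : W.IsChain (arc A) ↔ weight A W ≠ ⊥ := by
  induction W with
  | nil => simp [weight]
  | cons u W ih =>
    cases W with
    | nil => simp [weight]
    | cons v W =>
      rw [List.isChain_cons_cons, ih, weight_cons_cons]
      simp [arc, WithBot.add_eq_bot]

theorem weight_map_range {x : ℕ → Fin n} {c : ℕ → ℝ} {L : ℕ} (h : Traj A x c L) :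
    weight A ((List.range (L + 1)).map x) = ((c L - c 0 : ℝ) : Rmax) := by
  induction L with
  | zero => simp [weight]
  | succ L ih =>
    rw [List.range_succ, List.range_succ, List.map_append, List.map_append, List.append_assoc]
    have := ih (h.mono (by omega))
    rw [List.range_succ, List.map_append] at this
    simp only [List.map_cons, List.map_nil, List.nil_append, List.cons_append] at this ⊢
    rw [weight_append, this, weight_cons_cons, weight_singleton, h L (by omega), add_zero,
      ← WithBot.coe_add]
    congr 1
    ring

theorem exists_traj_of_list {W : List (Fin n)} (hne : W ≠ []) (hW : W.IsChain (arc A)) :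
    ∃ x c, Traj A x c (len W) ∧ W = (List.range (len W + 1)).map x ∧ c 0 = 0 ∧
      weight A W = ((c (len W) : ℝ) : Rmax) := by
  induction W with
  | nil => exact absurd rfl hne
  | cons u W ih =>
    cases W with
    | nil =>
      exact ⟨fun _ => u, fun _ => 0, fun k hk => absurd hk (by simp [len]), by simp [len], rfl,
        by simp [weight]⟩
    | cons v W =>
      rw [List.isChain_cons_cons] at hW
      obtain ⟨x, c, hx, h0, c0, c1⟩ := ih (by simp) hW.2
      obtain ⟨a, ha⟩ := WithBot.ne_bot_iff_exists.1 hW.1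
      have hv : x 0 = v := by
        have := congrArg List.head? h0
        simp [List.range_succ_eq_map] at this
        exact this.symm
      refine ⟨fun m => Nat.casesOn m u x, fun m => Nat.casesOn m 0 (fun m => a + c m), ?_, ?_,
        rfl, ?_⟩
      · rintro (_ | m) hm
        · simp [hv, c0, ha]
        · have := hx m (by simp [len] at hm ⊢; omega)
          simp only [this]
          congr 1
          ring
      · have hl : len (u :: v :: W) = len (v :: W) + 1 := by simp [len]
        rw [hl, List.range_succ_eq_map, List.map_cons, List.map_map]
        conv_lhs => rw [h0]
        rfl
      · have hl : len (u :: v :: W) = len (v :: W) + 1 := by simp [len]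
        rw [weight_cons_cons, c1, ← ha, hl, ← WithBot.coe_add]

theorem le_pow {i j : Fin n} {ℓ : ℕ} {w : ℝ} (h : Reach A i j ℓ w) :
    (w : Rmax) ≤ pow A ℓ i j := by
  induction h with
  | nil i => simp [pow, idm]
  | @cons i k j a ℓ w ha _ ih =>
    refine le_trans ?_ (Finset.le_sup (f := fun k => A i k + pow A ℓ k j) (Finset.mem_univ k))
    rw [WithBot.coe_add, ← ha]
    gcongr

theorem exists_of_mul_eq {i j : Fin n} {w : ℝ} (h : mul A B i j = (w : Rmax)) :
    ∃ (k : Fin n) (a b : ℝ), A i k = (a : Rmax) ∧ B k j = (b : Rmax) ∧ w = a + b := by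
  obtain ⟨k, -, hk⟩ := Finset.exists_mem_eq_sup Finset.univ ⟨i, Finset.mem_univ i⟩
    fun k => A i k + B k j
  have hs : A i k + B k j = (w : Rmax) := by rw [← hk]; exact h
  obtain ⟨a, b, ha, hb, hab⟩ := WithBot.add_eq_coe.1 hs
  exact ⟨k, a, b, ha.symm, hb.symm, hab.symm⟩

theorem le_mul {i k j : Fin n} {a b : ℝ} (ha : (a : Rmax) ≤ A i k) (hb : (b : Rmax) ≤ B k j) :
    ((a + b : ℝ) : Rmax) ≤ mul A B i j := by
  refine le_trans ?_ (Finset.le_sup (f := fun k => A i k + B k j) (Finset.mem_univ k))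
  rw [WithBot.coe_add]
  gcongr

theorem reach_of_pow {i j : Fin n} {ℓ : ℕ} {w : ℝ} (h : pow A ℓ i j = (w : Rmax)) :
    Reach A i j ℓ w := by
  induction ℓ generalizing i w with
  | zero =>
    simp only [pow, idm] at h
    split_ifs at h with hij
    · subst hij
      exact (Reach.nil i).cast rfl (by exact_mod_cast h)
    · exact absurd h.symm (WithBot.coe_ne_bot)
  | succ ℓ ih =>
    obtain ⟨k, a, b, ha, hb, hab⟩ := exists_of_mul_eq h
    exact (Reach.cons ha (ih hb)).cast rfl hab.symm

/-- Walks can be shortened to length less than `γ * n` without changing the length modulo `γ`,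
provided that closed walks have nonpositive weights. -/
theorem Reach.shrink (hcl : ∀ v ℓ w, Reach A v v ℓ w → w ≤ 0) {γ : ℕ} (hγ : 0 < γ) {i j : Fin n}
    {ℓ : ℕ} {w : ℝ} (h : Reach A i j ℓ w) :
    ∃ ℓ' w', Reach A i j ℓ' w' ∧ ℓ' < γ * n ∧ ℓ' ≡ ℓ [MOD γ] ∧ w ≤ w' := by
  induction ℓ using Nat.strong_induction_on generalizing w with
  | _ ℓ ih =>
    by_cases hℓ : ℓ < γ * n
    · exact ⟨ℓ, w, h, hℓ, rfl, le_rfl⟩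
    obtain ⟨x, c, hx, rfl, rfl, c0, rfl⟩ := h.exists_traj
    have hcard : (Finset.univ ×ˢ Finset.range γ : Finset (Fin n × ℕ)).card
        < (Finset.range (ℓ + 1)).card := by
      rw [Finset.card_product]; simp; nlinarith
    obtain ⟨a, ha, b, hb, hab, he⟩ := Finset.exists_ne_map_eq_of_card_lt_of_maps_to hcard
      (f := fun k => (x k, k % γ)) (fun k _ => by simp [Nat.mod_lt _ hγ])
    wlog hlt : a < b generalizing a b
    · exact this b hb a ha hab.symm he.symm (by omega)
    simp only [Finset.mem_range, Prod.mk.injEq] at ha hb he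
    have h1 := hx.seg (Nat.zero_le a) (by omega)
    have h2 := hx.seg (show b ≤ ℓ by omega) le_rfl
    rw [← he.1] at h2
    have h3 := hx.seg hlt.le (by omega)
    rw [← he.1] at h3
    have := hcl _ _ _ h3
    obtain ⟨ℓ', w', h', hl, hm, hw⟩ := ih _ (by omega) (h1.trans h2)
    refine ⟨ℓ', w', h', hl, hm.trans ?_, by linarith⟩
    have hd : (b - a) ≡ 0 [MOD γ] :=
      (Nat.modEq_zero_iff_dvd).2 ((Nat.modEq_iff_dvd' hlt.le).1 he.2)
    have := hd.add_left (a - 0 + (ℓ - b))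
    calc a - 0 + (ℓ - b) ≡ a - 0 + (ℓ - b) + (b - a) [MOD γ] := this.symm
      _ = ℓ := by omega

end

section

/-- The walk `x` of length `L` passes through a node of `Z` at time `f`; among the walks with the
same endpoints through `Z`, whose length is congruent to `L` modulo `g` and whose weight is at
least as large, it is of minimal length and, for this length, reaches `Z` earliest. -/
structure Config {n : ℕ} (A : Mat n) (Z : Finset (Fin n)) (g : ℕ) (x : ℕ → Fin n) (c : ℕ → ℝ)
    (f L : ℕ) : Prop where
  traj : Traj A x c L
  le : f ≤ L
  mem : x f ∈ Z
  closed : ∀ v ℓ w, Reach A v v ℓ w → w ≤ 0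
  minLen : ∀ z ∈ Z, ∀ ℓ₁ ℓ₂ w₁ w₂, Reach A (x 0) z ℓ₁ w₁ → Reach A z (x L) ℓ₂ w₂ →
    ℓ₁ + ℓ₂ ≡ L [MOD g] → c L - c 0 ≤ w₁ + w₂ → L ≤ ℓ₁ + ℓ₂
  minFirst : ∀ z ∈ Z, ∀ ℓ₁ ℓ₂ w₁ w₂, Reach A (x 0) z ℓ₁ w₁ → Reach A z (x L) ℓ₂ w₂ →
    ℓ₁ + ℓ₂ = L → c L - c 0 ≤ w₁ + w₂ → f ≤ ℓ₁

theorem modEq_of_add_eq {g a b k : ℕ} (h : a + k = b) (hk : g ∣ k) : a ≡ b [MOD g] := by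
  rw [← h]
  simpa using ((Nat.modEq_zero_iff_dvd.2 hk).add_left a).symm

namespace Config

variable {n : ℕ} {A : Mat n} {Z : Finset (Fin n)} {g : ℕ} {x : ℕ → Fin n} {c : ℕ → ℝ} {f L : ℕ}

theorem closed_seg (h : Config A Z g x c f L) {p q : ℕ} (hpq : p ≤ q) (hq : q ≤ L)
    (he : x p = x q) : c q - c p ≤ 0 := by
  have := h.traj.seg hpq hq
  rw [he] at this
  exact h.closed _ _ _ this

theorem false_of_shorter (h : Config A Z g x c f L) {ℓ w : _} (h₂ : Reach A (x f) (x L) ℓ w)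
    {k : ℕ} (hk : 0 < k) (hℓ : f + ℓ + k = L) (hd : g ∣ k) (hw : c L - c f ≤ w) : False := by
  have h₁ := h.traj.seg (Nat.zero_le f) h.le
  have := h.minLen _ h.mem _ _ _ _ h₁ h₂ (modEq_of_add_eq (k := k) (by omega) hd) (by linarith)
  omega

theorem not_dvd_sub (h : Config A Z g x c f L) {p q : ℕ} (hp : f ≤ p) (hpq : p < q) (hq : q ≤ L)
    (he : x p = x q) : ¬ g ∣ q - p := by
  intro hd
  have h₁ := h.traj.seg hp (by omega)
  have h₂ := h.traj.seg hq le_rfl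
  rw [← he] at h₂
  have := h.closed_seg hpq.le hq he
  exact h.false_of_shorter (h₁.trans h₂) (k := q - p) (by omega) (by omega) hd (by linarith)

theorem not_modEq (h : Config A Z g x c f L) {p q : ℕ} (hp : f ≤ p) (hpq : p < q) (hq : q ≤ L)
    (he : x p = x q) : p % g ≠ q % g :=
  fun hm => h.not_dvd_sub hp hpq hq he ((Nat.modEq_iff_dvd' hpq.le).1 hm)

theorem not_modEq_of_le (h : Config A Z g x c f L) {p q : ℕ} (hpq : p < q) (hq : q ≤ f)
    (he : x p = x q) : p % g ≠ q % g := by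
  intro hm
  have hd := (Nat.modEq_iff_dvd' hpq.le).1 hm
  have hfL := h.le
  have h₁ := h.traj.seg (Nat.zero_le p) (by omega)
  have h₂ := h.traj.seg hq h.le
  rw [← he] at h₂
  have := h.closed_seg hpq.le (by omega) he
  have := h.minLen _ h.mem _ _ _ _ (h₁.trans h₂) (h.traj.seg h.le le_rfl)
    (modEq_of_add_eq (k := q - p) (by omega) hd) (by linarith)
  omega

theorem not_repeat_prefix (h : Config A Z g x c f L) {p q r : ℕ} (hpq : p < q) (hq : q ≤ f)
    (hr : f ≤ r) (hrL : r ≤ L) (he : x p = x q) (he' : x q = x r) : False := by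
  have h₁ := h.traj.seg (Nat.zero_le p) (by omega)
  have h₂ := h.traj.seg hq h.le
  have h₃ := h.traj.seg hr hrL
  have h₄ := h.traj.seg hpq.le (by omega)
  have h₅ := h.traj.seg hrL le_rfl
  rw [← he] at h₂
  rw [← he', ← he] at h₃
  rw [← he] at h₄
  rw [← he', ← he] at h₅
  have := h.minFirst _ h.mem _ _ _ _ (h₁.trans h₂) (h₃.trans (h₄.trans h₅)) (by omega)
    (by linarith)
  omega

theorem notMem_of_lt (h : Config A Z g x c f L) {k : ℕ} (hk : k < f) : x k ∉ Z := by
  intro hz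
  have hfL := h.le
  have := h.minFirst _ hz _ _ _ _ (h.traj.seg (Nat.zero_le k) (by omega))
    (h.traj.seg (show k ≤ L by omega) le_rfl) (by omega) (by linarith)
  omega

theorem card_image_mod_suffix (h : Config A Z g x c f L) (v : Fin n) :
    (((Finset.Icc f L).filter (x · = v)).image (· % g)).card
      = ((Finset.Icc f L).filter (x · = v)).card := by
  refine Finset.card_image_of_injOn fun p hp q hq hpq => ?_
  simp only [Finset.coe_filter, Finset.mem_Icc, Set.mem_ofPred_eq] at hp hq
  rcases lt_trichotomy p q with hlt | heq | hlt
  · exact absurd hpq (h.not_modEq hp.1.1 hlt hq.1.2 (by rw [hp.2, hq.2]))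
  · exact heq
  · exact absurd hpq.symm (h.not_modEq hq.1.1 hlt hp.1.2 (by rw [hp.2, hq.2]))

theorem image_mod_subset (hg : 0 < g) (s : Finset ℕ) : s.image (· % g) ⊆ Finset.range g := by
  intro k hk
  obtain ⟨p, -, rfl⟩ := Finset.mem_image.1 hk
  exact Finset.mem_range.2 (Nat.mod_lt _ hg)

theorem card_suffix_le (h : Config A Z g x c f L) (hg : 0 < g) (v : Fin n) :
    ((Finset.Icc f L).filter (x · = v)).card ≤ g := by
  rw [← h.card_image_mod_suffix v]
  simpa using Finset.card_le_card (image_mod_subset hg _)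

theorem card_prefix_le (h : Config A Z g x c f L) (hg : 0 < g) (v : Fin n) :
    ((Finset.range f).filter (x · = v)).card ≤ g := by
  have : (((Finset.range f).filter (x · = v)).image (· % g)).card
      = ((Finset.range f).filter (x · = v)).card := by
    refine Finset.card_image_of_injOn fun p hp q hq hpq => ?_
    simp only [Finset.coe_filter, Finset.mem_range, Set.mem_ofPred_eq] at hp hq
    rcases lt_trichotomy p q with hlt | heq | hlt
    · exact absurd hpq (h.not_modEq_of_le hlt (by omega) (by rw [hp.2, hq.2]))
    · exact heq
    · exact absurd hpq.symm (h.not_modEq_of_le hlt (by omega) (by rw [hp.2, hq.2]))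
  rw [← this]
  simpa using Finset.card_le_card (image_mod_subset hg _)

theorem card_prefix_eq_zero (h : Config A Z g x c f L) {v : Fin n} (hv : v ∈ Z) :
    ((Finset.range f).filter (x · = v)).card = 0 := by
  rw [Finset.card_eq_zero, Finset.filter_eq_empty_iff]
  rintro k hk rfl
  exact h.notMem_of_lt (Finset.mem_range.1 hk) hv

theorem card_prefix_le_one (h : Config A Z g x c f L) {v : Fin n}
    (hv : ((Finset.Icc f L).filter (x · = v)).card ≠ 0) :
    ((Finset.range f).filter (x · = v)).card ≤ 1 := by
  obtain ⟨r, hr⟩ := Finset.card_ne_zero.1 hv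
  simp only [Finset.mem_filter, Finset.mem_Icc] at hr
  refine Finset.card_le_one.2 fun p hp q hq => ?_
  simp only [Finset.mem_filter, Finset.mem_range] at hp hq
  rcases lt_trichotomy p q with hlt | heq | hlt
  · exact (h.not_repeat_prefix hlt (by omega) hr.1.1 hr.1.2 (by rw [hp.2, hq.2])
      (by rw [hq.2, hr.2])).elim
  · exact heq
  · exact (h.not_repeat_prefix hlt (by omega) hr.1.1 hr.1.2 (by rw [hp.2, hq.2])
      (by rw [hp.2, hr.2])).elim

theorem card_add_card_le (h : Config A Z g x c f L) (hg : 2 ≤ g) (v : Fin n) :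
    ((Finset.range f).filter (x · = v)).card + ((Finset.Icc f L).filter (x · = v)).card
      ≤ g + if v ∈ Z then 0 else 1 := by
  have h₁ := h.card_suffix_le (by omega) v
  have h₂ := h.card_prefix_le (by omega) v
  split_ifs with hv
  · have := h.card_prefix_eq_zero hv
    omega
  · by_cases h₀ : ((Finset.Icc f L).filter (x · = v)).card = 0
    · omega
    · have := h.card_prefix_le_one h₀
      omega

theorem sum_bound (hZ : Z.card = g) :
    ∑ v : Fin n, (g + if v ∈ Z then 0 else 1) + g = g * n + n := by
  have h₁ : ∀ v : Fin n, (g + if v ∈ Z then 0 else 1) + (if v ∈ Z then 1 else 0) = g + 1 := by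
    intro v; split_ifs <;> omega
  have h₂ : ∑ v : Fin n, (if v ∈ Z then 1 else 0) = g := by simp [hZ]
  conv_lhs => rw [← h₂]
  rw [← Finset.sum_add_distrib, Finset.sum_congr rfl fun v _ => by rw [h₂, h₁ v]]
  simp
  ring

theorem card_add_card_eq (h : Config A Z g x c f L) (hg : 2 ≤ g) (hZ : Z.card = g)
    (hL : g * n + n ≤ L + 1 + g) (v : Fin n) :
    ((Finset.range f).filter (x · = v)).card + ((Finset.Icc f L).filter (x · = v)).card
      = g + if v ∈ Z then 0 else 1 := by
  have hle : ∀ v ∈ Finset.univ, ((Finset.range f).filter (x · = v)).card +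
      ((Finset.Icc f L).filter (x · = v)).card ≤ g + if v ∈ Z then 0 else 1 :=
    fun v _ => h.card_add_card_le hg v
  refine (Finset.sum_eq_sum_iff_of_le hle).1 (le_antisymm (Finset.sum_le_sum hle) ?_) v
    (Finset.mem_univ v)
  rw [Finset.sum_add_distrib (f := fun v => ((Finset.range f).filter (x · = v)).card),
    ← Finset.card_eq_sum_card_fiberwise (f := x) (t := Finset.univ) (fun _ _ => by simp),
    ← Finset.card_eq_sum_card_fiberwise (f := x) (t := Finset.univ) (fun _ _ => by simp),
    Finset.card_range, Nat.card_Icc]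
  have := sum_bound (n := n) hZ
  have := h.le
  omega

theorem card_suffix_eq (h : Config A Z g x c f L) (hg : 2 ≤ g) (hZ : Z.card = g)
    (hL : g * n + n ≤ L + 1 + g) (v : Fin n) :
    ((Finset.Icc f L).filter (x · = v)).card = g := by
  have h₁ := h.card_suffix_le (by omega) v
  have h₂ := h.card_prefix_le (by omega) v
  have h₃ := h.card_add_card_eq hg hZ hL v
  split_ifs at h₃ with hv
  · have := h.card_prefix_eq_zero hv
    omega
  · by_cases h₀ : ((Finset.Icc f L).filter (x · = v)).card = 0
    · omega
    · have := h.card_prefix_le_one h₀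
      omega

theorem suffix_length (h : Config A Z g x c f L) (hg : 2 ≤ g) (hZ : Z.card = g)
    (hL : g * n + n ≤ L + 1 + g) : L + 1 = f + g * n := by
  have := Finset.card_eq_sum_card_fiberwise (f := x) (s := Finset.Icc f L) (t := Finset.univ)
    (fun _ _ => by simp)
  rw [Finset.sum_congr rfl fun v _ => h.card_suffix_eq hg hZ hL v] at this
  simp only [Nat.card_Icc, Finset.sum_const, Finset.card_univ, Fintype.card_fin,
    smul_eq_mul] at this
  have := h.le
  rw [mul_comm g n]
  omega

theorem exists_modEq (h : Config A Z g x c f L) (hg : 2 ≤ g) (hZ : Z.card = g)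
    (hL : g * n + n ≤ L + 1 + g) (v : Fin n) (ρ : ℕ) :
    ∃ k, f ≤ k ∧ k ≤ L ∧ x k = v ∧ k ≡ ρ [MOD g] := by
  have himg : ((Finset.Icc f L).filter (x · = v)).image (· % g) = Finset.range g := by
    refine Finset.eq_of_subset_of_card_le (image_mod_subset (by omega) _) ?_
    rw [h.card_image_mod_suffix v, h.card_suffix_eq hg hZ hL v, Finset.card_range]
  have hρ : ρ % g ∈ Finset.range g := Finset.mem_range.2 (Nat.mod_lt _ (by omega))
  rw [← himg, Finset.mem_image] at hρ
  obtain ⟨k, hk, hkρ⟩ := hρ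
  simp only [Finset.mem_filter, Finset.mem_Icc] at hk
  exact ⟨k, hk.1.1, hk.1.2, hk.2, hkρ⟩

theorem exists_prefix (h : Config A Z g x c f L) (hg : 2 ≤ g) (hZ : Z.card = g)
    (hL : g * n + n ≤ L + 1 + g) {v : Fin n} (hv : v ∉ Z) : ∃ k < f, x k = v := by
  have h₁ := h.card_suffix_eq hg hZ hL v
  have h₂ := h.card_add_card_eq hg hZ hL v
  rw [if_neg hv] at h₂
  have : ((Finset.range f).filter (x · = v)).card ≠ 0 := by omega
  obtain ⟨k, hk⟩ := Finset.card_ne_zero.1 this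
  simp only [Finset.mem_filter, Finset.mem_range] at hk
  exact ⟨k, hk.1, hk.2⟩

end Config

end

section

namespace Config

variable {n : ℕ} {A : Mat n} {Z : Finset (Fin n)} {g : ℕ} {x : ℕ → Fin n} {c : ℕ → ℝ} {f L : ℕ}

/-- If a closed piece `[s, t]` misses a node `v` occurring later, first at time `q`, then `v` also
occurs earlier and the nodes of the piece do not occur after `q`. -/
theorem of_first_after (h : Config A Z g x c f L) (hg : 2 ≤ g) (hZ : Z.card = g)
    (hL : g * n + n ≤ L + 1 + g) {s t q : ℕ} (hs : f ≤ s) (hst : s < t) (htq : t < q)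
    (hq : q ≤ L) (he : x s = x t) (hv : ∀ k, s ≤ k → k < q → x k ≠ x q) :
    (∃ p, f ≤ p ∧ p < s ∧ x p = x q) ∧
      ∀ r, q < r → r ≤ L → ∀ e, s ≤ e → e ≤ t → x r ≠ x e := by
  obtain ⟨b, hfb, hbL, hb, hmod⟩ := h.exists_modEq hg hZ hL (x q) (q + (g - 1) * (t - s))
  have hcl := h.closed_seg hst.le (by omega) he
  have hmod' : b + (t - s) ≡ q [MOD g] := by
    refine (hmod.add_right (t - s)).trans ?_
    refine (modEq_of_add_eq (k := g * (t - s)) ?_ (dvd_mul_right _ _)).symm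
    obtain ⟨g', rfl⟩ : ∃ g', g = g' + 1 := ⟨g - 1, by omega⟩
    simp only [Nat.add_sub_cancel]
    ring
  have hbq : b < q := by
    by_contra! hle
    have hd : g ∣ (b - q) + (t - s) := by
      have := (Nat.modEq_iff_dvd' (by omega)).1 hmod'.symm
      rwa [show b + (t - s) - q = (b - q) + (t - s) by omega] at this
    have h₁ := h.traj.seg hs (by omega)
    have h₂ := h.traj.seg htq.le hq
    have h₃ := h.traj.seg hbL le_rfl
    rw [← he] at h₂
    rw [hb] at h₃
    have := h.closed_seg hle hbL hb.symm
    exact h.false_of_shorter (h₁.trans (h₂.trans h₃)) (k := (b - q) + (t - s)) (by omega)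
      (by omega) hd (by linarith)
  have hbs : b < s := by
    by_contra! hle
    exact hv b hle hbq hb
  refine ⟨⟨b, hfb, hbs, hb⟩, fun r hqr hrL e hse het hre => ?_⟩
  have h₁ := h.traj.seg hfb hbL
  have h₂ := h.traj.seg hqr.le hrL
  have h₃ := h.traj.seg het (by omega)
  have h₄ := h.traj.seg hse (by omega)
  have h₅ := h.traj.seg hrL le_rfl
  have h₆ := h.traj.seg hbs.le (by omega)
  have h₇ := h.traj.seg htq.le hq
  rw [hb] at h₁ h₆
  rw [hre] at h₂ h₅
  rw [← he] at h₃ h₇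
  have := h.closed _ _ _ (h₆.trans h₇)
  have hd : g ∣ (q - b) - (t - s) := by
    have := (Nat.modEq_iff_dvd' (by omega)).1 hmod'
    rwa [show q - (b + (t - s)) = (q - b) - (t - s) by omega] at this
  exact h.false_of_shorter (h₁.trans (h₂.trans (h₃.trans (h₄.trans h₅))))
    (k := (q - b) - (t - s)) (by omega) (by omega) hd (by linarith)

/-- If a closed piece `[s, t]` misses a node `v` occurring before it, last at time `p`, then `v`
also occurs later and the nodes of the piece do not occur before `p`. -/
theorem of_last_before (h : Config A Z g x c f L) (hg : 2 ≤ g) (hZ : Z.card = g)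
    (hL : g * n + n ≤ L + 1 + g) {s t p : ℕ} (hp : f ≤ p) (hps : p < s) (hst : s < t)
    (ht : t ≤ L) (he : x s = x t) (hv : ∀ k, p < k → k ≤ t → x k ≠ x p) :
    (∃ q, t < q ∧ q ≤ L ∧ x q = x p) ∧
      ∀ r, r < p → ∀ e, s ≤ e → e ≤ t → x r ≠ x e := by
  obtain ⟨b, hfb, hbL, hb, hmod⟩ := h.exists_modEq hg hZ hL (x p) (p + (t - s))
  have hcl := h.closed_seg hst.le ht he
  have hfL := h.le
  have hpb : p < b := by
    by_contra! hle
    have hd : g ∣ (p - b) + (t - s) := by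
      have := (Nat.modEq_iff_dvd' (by omega)).1 hmod
      rwa [show p + (t - s) - b = (p - b) + (t - s) by omega] at this
    have h₁ := h.traj.seg hfb hbL
    have h₂ := h.traj.seg hps.le (by omega)
    have h₃ := h.traj.seg ht le_rfl
    rw [hb] at h₁
    rw [← he] at h₃
    have := h.closed_seg hle (by omega) hb
    exact h.false_of_shorter (h₁.trans (h₂.trans h₃)) (k := (p - b) + (t - s)) (by omega)
      (by omega) hd (by linarith)
  have htb : t < b := by
    by_contra! hle
    exact hv b hpb hle hb
  refine ⟨⟨b, htb, hbL, hb⟩, fun r hrp e hse het hre => ?_⟩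
  have h₃ := h.traj.seg het (by omega)
  have h₄ := h.traj.seg hse (by omega)
  have h₆ := h.traj.seg hps.le (by omega)
  have h₇ := h.traj.seg htb.le hbL
  have h₈ := h.traj.seg hbL le_rfl
  rw [← he] at h₃ h₇
  rw [hb] at h₇ h₈
  have := h.closed _ _ _ (h₆.trans h₇)
  have hd : g ∣ (b - p) - (t - s) := by
    have := (Nat.modEq_iff_dvd' (by omega)).1 hmod.symm
    rwa [show b - (p + (t - s)) = (b - p) - (t - s) by omega] at this
  rcases le_total f r with hfr | hrf
  · have h₁ := h.traj.seg hfr (by omega)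
    have h₂ := h.traj.seg hrp.le (by omega)
    rw [hre] at h₁ h₂
    exact h.false_of_shorter (h₁.trans (h₃.trans (h₄.trans (h₂.trans h₈))))
      (k := (b - p) - (t - s)) (by omega) (by omega) hd (by linarith)
  · have h₁ := h.traj.seg (Nat.zero_le r) (by omega)
    have h₂ := h.traj.seg hrf h.le
    have h₅ := h.traj.seg hp (by omega)
    rw [hre] at h₁ h₂
    have := h.minLen _ h.mem _ _ _ _ (h₁.trans (h₃.trans (h₄.trans h₂))) (h₅.trans h₈)
      (modEq_of_add_eq (k := (b - p) - (t - s)) (by omega) hd) (by linarith)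
    omega

theorem exists_first_after {x : ℕ → Fin n} {t k : ℕ} (htk : t < k) :
    ∃ q, t < q ∧ q ≤ k ∧ x q = x k ∧ ∀ m, t < m → m < q → x m ≠ x k := by
  have hex : ∃ q, t < q ∧ x q = x k := ⟨k, htk, rfl⟩
  refine ⟨Nat.find hex, (Nat.find_spec hex).1, Nat.find_min' hex ⟨htk, rfl⟩,
    (Nat.find_spec hex).2, fun m htm hm he => Nat.find_min hex hm ⟨htm, he⟩⟩

theorem exists_last_before {x : ℕ → Fin n} {s k : ℕ} (hks : k < s) :
    ∃ p, k ≤ p ∧ p < s ∧ x p = x k ∧ ∀ m, p < m → m < s → x m ≠ x k := by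
  refine ⟨Nat.findGreatest (fun m => x m = x k) (s - 1), Nat.le_findGreatest (by omega) rfl, ?_,
    Nat.findGreatest_spec (P := fun m => x m = x k) (m := k) (by omega) rfl,
    fun m h₁ h₂ => Nat.findGreatest_is_greatest h₁ (by omega)⟩
  have := Nat.findGreatest_le (P := fun m => x m = x k) (s - 1)
  omega

/-- A closed piece missing a node `v` lies between two consecutive occurrences of `v`, and its nodes
occur nowhere else. -/
theorem exists_gap (h : Config A Z g x c f L) (hg : 2 ≤ g) (hZ : Z.card = g)
    (hL : g * n + n ≤ L + 1 + g) {s t : ℕ} (hs : f ≤ s) (hst : s < t) (ht : t ≤ L)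
    (he : x s = x t) {v : Fin n} (hv : ∀ k, s ≤ k → k ≤ t → x k ≠ v) :
    ∃ p q, f ≤ p ∧ p < s ∧ t < q ∧ q ≤ L ∧ x p = v ∧ x q = v ∧
      (∀ k, p < k → k < q → x k ≠ v) ∧
      (∀ r, r ≤ L → r < p ∨ q < r → ∀ e, s ≤ e → e ≤ t → x r ≠ x e) := by
  have right : ∀ k, t < k → k ≤ L → x k = v → ∃ q, t < q ∧ q ≤ L ∧ x q = v ∧
      (∀ m, s ≤ m → m < q → x m ≠ v) ∧ (∃ p, f ≤ p ∧ p < s ∧ x p = v) ∧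
      ∀ r, q < r → r ≤ L → ∀ e, s ≤ e → e ≤ t → x r ≠ x e := by
    rintro k htk hkL rfl
    obtain ⟨q, htq, hqk, hq, hmin⟩ := exists_first_after (x := x) htk
    have hmin' : ∀ m, s ≤ m → m < q → x m ≠ x q := fun m hsm hmq => by
      rw [hq]
      by_cases hmt : m ≤ t
      · exact hv m hsm hmt
      · exact hmin m (by omega) hmq
    have := h.of_first_after hg hZ hL hs hst htq (by omega) he hmin'
    rw [hq] at this hmin'
    exact ⟨q, htq, by omega, hq, hmin', this.1, this.2⟩
  have left : ∀ k, f ≤ k → k < s → x k = v → ∃ p, f ≤ p ∧ p < s ∧ x p = v ∧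
      (∀ m, p < m → m ≤ t → x m ≠ v) ∧ (∃ q, t < q ∧ q ≤ L ∧ x q = v) ∧
      ∀ r, r < p → ∀ e, s ≤ e → e ≤ t → x r ≠ x e := by
    rintro k hfk hks rfl
    obtain ⟨p, hkp, hps, hp, hmax⟩ := exists_last_before (x := x) hks
    have hmax' : ∀ m, p < m → m ≤ t → x m ≠ x p := fun m hpm hmt => by
      rw [hp]
      by_cases hms : m < s
      · exact hmax m hpm hms
      · exact hv m (by omega) hmt
    have := h.of_last_before hg hZ hL (by omega) hps hst ht he hmax'
    rw [hp] at this hmax'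
    exact ⟨p, by omega, hps, hp, hmax', this.1, this.2⟩
  obtain ⟨k, hfk, hkL, hk, -⟩ := h.exists_modEq hg hZ hL v 0
  have hbefore : ∃ k, f ≤ k ∧ k < s ∧ x k = v := by
    by_cases hks : k < s
    · exact ⟨k, hfk, hks, hk⟩
    · have htk : t < k := by
        by_contra! hle
        exact hv k (by omega) hle hk
      obtain ⟨q, -, -, -, -, hp, -⟩ := right k htk hkL hk
      exact hp
  obtain ⟨k, hfk, hks, hk⟩ := hbefore
  obtain ⟨p, hfp, hps, hp, hmax, ⟨k', htk', hk'L, hk'⟩, hleft⟩ := left k hfk hks hk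
  obtain ⟨q, htq, hqL, hq, hmin, -, hright⟩ := right k' htk' hk'L hk'
  refine ⟨p, q, hfp, hps, htq, hqL, hp, hq, fun m hpm hmq => ?_, fun r hrL hr e hse het => ?_⟩
  · by_cases hmt : m ≤ t
    · exact hmax m hpm hmt
    · exact hmin m (by omega) hmq
  · rcases hr with hr | hr
    · exact hleft r hr e hse het
    · exact hright r hr hrL e hse het

theorem covers_of_mem (h : Config A Z g x c f L) (hg : 2 ≤ g) (hZ : Z.card = g)
    (hL : g * n + n ≤ L + 1 + g) {s t e : ℕ} (hs : f ≤ s) (hst : s < t) (ht : t ≤ L)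
    (he : x s = x t) (hse : s ≤ e) (het : e ≤ t) (hez : x e = x f) (v : Fin n) :
    ∃ k, s ≤ k ∧ k ≤ t ∧ x k = v := by
  by_contra! hv
  obtain ⟨p, q, hfp, hps, -, -, hp, -, -, hout⟩ := h.exists_gap hg hZ hL hs hst ht he hv
  rcases hfp.lt_or_eq with hlt | rfl
  · exact hout f h.le (.inl hlt) e hse het hez.symm
  · exact hv e hse het (hez.trans hp)

/-- Every closed piece after time `f` visits all nodes. -/
theorem covers (h : Config A Z g x c f L) (hg : 2 ≤ g) (hZ : Z.card = g)
    (hL : g * n + n ≤ L + 1 + g) (hne : ¬(n = 2 ∧ g = 2))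
    (hcyc : ∀ z ∈ Z, ∀ u ∈ Z, ∃ ℓ₁ ℓ₂ a, ℓ₁ + ℓ₂ = g ∧ Reach A z u ℓ₁ a ∧ Reach A u z ℓ₂ (-a))
    {s t : ℕ} (hs : f ≤ s) (hst : s < t) (ht : t ≤ L) (he : x s = x t) (v : Fin n) :
    ∃ k, s ≤ k ∧ k ≤ t ∧ x k = v := by
  by_contra! hv
  have hz : ∀ k, s ≤ k → k ≤ t → x k ≠ x f := fun k hsk hkt hk => by
    obtain ⟨m, hsm, hmt, hm⟩ := h.covers_of_mem hg hZ hL hs hst ht he hsk hkt hk v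
    exact hv m hsm hmt hm
  obtain ⟨p, q, hfp, hps, htq, hqL, hp, hq, hgap, hout⟩ := h.exists_gap hg hZ hL hs hst ht he hz
  have only : ∀ k, f ≤ k → k ≤ L → x k = x f → k = p ∨ k = q := by
    intro k hfk hkL hk
    by_contra! hkpq
    have hk' : k < p ∨ q < k := by
      by_contra! hcon
      exact hgap k (by omega) (by omega) hk
    rcases hk' with hlt | hlt
    · obtain ⟨m, hkm, hmp, hm⟩ := h.covers_of_mem hg hZ hL hfk hlt (by omega) (hk.trans hp.symm)
        le_rfl hlt.le hk (x s)
      rcases hmp.lt_or_eq with hmp | rfl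
      · exact hout m (by omega) (.inl hmp) s le_rfl hst.le hm
      · exact hz s le_rfl hst.le (hm.symm.trans hp)
    · obtain ⟨m, hqm, hmk, hm⟩ := h.covers_of_mem hg hZ hL (by omega) hlt hkL (hq.trans hk.symm)
        le_rfl hlt.le hq (x s)
      rcases hqm.lt_or_eq with hqm | rfl
      · exact hout m (by omega) (.inr hqm) s le_rfl hst.le hm
      · exact hz s le_rfl hst.le (hm.symm.trans hq)
  have hg2 : g = 2 := by
    by_contra hg2
    have hsub : Finset.range 3 ⊆ ({p % g, q % g} : Finset ℕ) := by
      intro ρ hρ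
      obtain ⟨k, hfk, hkL, hk, hkρ⟩ := h.exists_modEq hg hZ hL (x f) ρ
      have hρ' : ρ % g = ρ := Nat.mod_eq_of_lt (by simp at hρ; omega)
      have hkρ : k % g = ρ := by rw [← hρ']; exact hkρ
      rcases only k hfk hkL hk with rfl | rfl <;> simp [hkρ]
    have := (Finset.card_le_card hsub).trans Finset.card_le_two
    simp at this
  have memZ : ∀ e, s ≤ e → e ≤ t → x e ∈ Z := by
    intro e hse het
    by_contra hnot
    obtain ⟨r, hr, hre⟩ := h.exists_prefix hg hZ hL hnot
    exact hout r (by omega) (.inl (by omega)) e hse het hre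
  have hodd₁ := h.not_dvd_sub hfp (by omega : p < q) hqL (hp.trans hq.symm)
  have hodd₂ := h.not_dvd_sub hs hst ht he
  subst hg2
  obtain ⟨ℓ₁, ℓ₂, a, hℓ, hzu, huz⟩ := hcyc _ h.mem _ (memZ s le_rfl hst.le)
  have hpq : q - p ≤ (t - s) + 2 := by
    by_contra! hlt
    have h₁ := h.traj.seg hfp (by omega)
    have h₂ := h.traj.seg hst.le ht
    have h₃ := h.traj.seg hqL le_rfl
    have h₄ := h.traj.seg hps.le (by omega)
    have h₅ := h.traj.seg htq.le hqL
    rw [hp] at h₁ h₄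
    rw [hq] at h₃ h₅
    rw [← he] at h₂ h₅
    have := h.closed _ _ _ (h₄.trans h₅)
    exact h.false_of_shorter (h₁.trans (hzu.trans (h₂.trans (huz.trans h₃))))
      (k := (q - p) - ((t - s) + 2)) (by omega) (by omega) (by omega) (by linarith)
  have huniv : (Finset.univ : Finset (Fin n)) ⊆ Z := by
    intro u _
    obtain ⟨k, hpk, hkq, rfl⟩ := h.covers_of_mem hg hZ hL hfp (by omega : p < q) hqL
      (hp.trans hq.symm) le_rfl (by omega) hp u
    by_cases hk : s ≤ k ∧ k ≤ t
    · exact memZ k hk.1 hk.2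
    · have : k = p ∨ k = q := by omega
      rcases this with rfl | rfl
      · rw [hp]; exact h.mem
      · rw [hq]; exact h.mem
  have h₁ := Finset.card_le_card huniv
  have h₂ := Finset.card_le_univ Z
  simp at h₁ h₂
  omega

theorem le_sub_of_eq (h : Config A Z g x c f L) (hg : 2 ≤ g) (hZ : Z.card = g)
    (hL : g * n + n ≤ L + 1 + g) (hne : ¬(n = 2 ∧ g = 2))
    (hcyc : ∀ z ∈ Z, ∀ u ∈ Z, ∃ ℓ₁ ℓ₂ a, ℓ₁ + ℓ₂ = g ∧ Reach A z u ℓ₁ a ∧ Reach A u z ℓ₂ (-a))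
    {s t : ℕ} (hs : f ≤ s) (hst : s < t) (ht : t ≤ L) (he : x s = x t) : n ≤ t - s := by
  have hsub : (Finset.univ : Finset (Fin n)) ⊆ (Finset.Ico s t).image x := by
    intro v _
    obtain ⟨k, hsk, hkt, rfl⟩ := h.covers hg hZ hL hne hcyc hs hst ht he v
    rcases hkt.lt_or_eq with hlt | rfl
    · exact Finset.mem_image_of_mem _ (Finset.mem_Ico.2 ⟨hsk, hlt⟩)
    · rw [← he]
      exact Finset.mem_image_of_mem _ (Finset.mem_Ico.2 ⟨le_rfl, hst⟩)
  have := (Finset.card_le_card hsub).trans Finset.card_image_le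
  simpa using this

theorem periodic (h : Config A Z g x c f L) (hg : 2 ≤ g) (hZ : Z.card = g)
    (hL : g * n + n ≤ L + 1 + g) (hne : ¬(n = 2 ∧ g = 2))
    (hcyc : ∀ z ∈ Z, ∀ u ∈ Z, ∃ ℓ₁ ℓ₂ a, ℓ₁ + ℓ₂ = g ∧ Reach A z u ℓ₁ a ∧ Reach A u z ℓ₂ (-a))
    {k : ℕ} (hk : f ≤ k) (hkL : k + n ≤ L) : x (k + n) = x k := by
  have hcard : (Finset.univ : Finset (Fin n)).card < (Finset.Icc k (k + n)).card := by
    simp only [Finset.card_univ, Fintype.card_fin, Nat.card_Icc]; omega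
  obtain ⟨a, ha, b, hb, hab, he⟩ := Finset.exists_ne_map_eq_of_card_lt_of_maps_to hcard
    (f := x) (fun k _ => by simp)
  wlog hlt : a < b generalizing a b
  · exact this b hb a ha hab.symm he.symm (by omega)
  simp only [Finset.mem_Icc] at ha hb
  have := h.le_sub_of_eq hg hZ hL hne hcyc (by omega) hlt (by omega) he
  obtain rfl : a = k := by omega
  obtain rfl : b = a + n := by omega
  exact he.symm

end Config

end

section

variable {n : ℕ} {A : Mat n}

theorem IsCycle.exists_eq {R : Fin n → Fin n → Prop} {W : List (Fin n)} (h : IsCycle R W) :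
    ∃ v l, W = v :: l ++ [v] := by
  obtain ⟨h₁, -, h₃, -⟩ := h
  have hne : W ≠ [] := by rintro rfl; simp at h₁
  obtain ⟨l, b, rfl⟩ : ∃ l b, W = l ++ [b] :=
    ⟨W.dropLast, W.getLast hne, (List.dropLast_append_getLast hne).symm⟩
  cases l with
  | nil => simp at h₁
  | cons v l =>
    rw [List.getLast?_concat] at h₃
    simp at h₃
    exact ⟨v, l, by rw [h₃]⟩

theorem dropLast_map_range (x : ℕ → Fin n) (ℓ : ℕ) :
    ((List.range (ℓ + 1)).map x).dropLast = (List.range ℓ).map x := by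
  rw [List.range_succ, List.map_append]
  simp

theorem isWalkFrom_map_range {x : ℕ → Fin n} {c : ℕ → ℝ} {ℓ : ℕ} (h : Traj A x c ℓ) :
    IsWalkFrom (arc A) ((List.range (ℓ + 1)).map x) (x 0) (x ℓ) := by
  refine ⟨⟨by simp, ?_⟩, ?_, ?_⟩
  · refine (chain_iff_weight_ne_bot _).2 ?_
    rw [weight_map_range h]
    exact WithBot.coe_ne_bot
  · simp [List.range_succ_eq_map]
  · simp [List.range_succ]

theorem isCycle_map_range {x : ℕ → Fin n} {c : ℕ → ℝ} {ℓ : ℕ} (h : Traj A x c ℓ) (hℓ : 0 < ℓ)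
    (he : x 0 = x ℓ) (hinj : ∀ a b, a < b → b < ℓ → x a ≠ x b) :
    IsCycle (arc A) ((List.range (ℓ + 1)).map x) := by
  obtain ⟨⟨-, h₁⟩, h₂, h₃⟩ := isWalkFrom_map_range h
  refine ⟨by simp; omega, h₁, by rw [h₂, h₃, he], ?_⟩
  rw [dropLast_map_range]
  refine List.Nodup.map_on ?_ List.nodup_range
  intro a ha b hb hab
  simp only [List.mem_range] at ha hb
  rcases lt_trichotomy a b with hlt | heq | hlt
  · exact absurd hab (hinj a b hlt hb)
  · exact heq
  · exact absurd hab.symm (hinj b a hlt ha)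

theorem len_map_range (x : ℕ → Fin n) (ℓ : ℕ) : len ((List.range (ℓ + 1)).map x) = ℓ := by
  simp [len]

theorem mean_eq {W : List (Fin n)} {w : ℝ} (h : weight A W = (w : Rmax)) :
    mean A W = ((w / (len W : ℝ) : ℝ) : Rmax) := by
  rw [mean, h]; rfl

theorem bddAbove_mean (A : Mat n) : BddAbove {m | ∃ W, IsCycle (arc A) W ∧ m = mean A W} := by
  refine Set.Finite.bddAbove (((List.finite_length_le (Fin n) (n + 1)).image (mean A)).subset ?_)
  rintro m ⟨W, ⟨-, -, -, hW⟩, rfl⟩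
  refine ⟨W, ?_, rfl⟩
  have := hW.length_le_card
  simp at this ⊢
  omega

theorem IsCycle.weight_nonpos {W : List (Fin n)} {w : ℝ} (hlam : lam A = 0)
    (h : IsCycle (arc A) W) (hw : weight A W = (w : Rmax)) : w ≤ 0 := by
  have h₁ : mean A W ≤ lam A := le_csSup (bddAbove_mean A) ⟨W, h, rfl⟩
  rw [mean_eq hw, hlam] at h₁
  have hlen : (0 : ℝ) < len W := by
    have := h.1
    simp only [len, Nat.cast_pos]; omega
  have h₂ : w / (len W : ℝ) ≤ 0 := by exact_mod_cast h₁
  by_contra! hpos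
  have := div_pos hpos hlen
  linarith

theorem IsCritCycle.weight_eq {W : List (Fin n)} (hlam : lam A = 0) (h : IsCritCycle A W) :
    weight A W = 0 := by
  obtain ⟨w, hw⟩ := WithBot.ne_bot_iff_exists.1 ((chain_iff_weight_ne_bot W).1 h.1.2.1)
  have hlen : (len W : ℝ) ≠ 0 := by
    have := h.1.1
    simp only [len, ne_eq, Nat.cast_eq_zero]; omega
  have := h.2
  rw [mean_eq hw.symm, hlam] at this
  have h₂ : w / (len W : ℝ) = 0 := by exact_mod_cast this
  rw [← hw]
  have : w = 0 := by simpa [hlen] using h₂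
  simp [this]

theorem closed_nonpos (hlam : lam A = 0) (v : Fin n) (ℓ : ℕ) (w : ℝ) (h : Reach A v v ℓ w) :
    w ≤ 0 := by
  induction ℓ using Nat.strong_induction_on generalizing v w with
  | _ ℓ ih =>
    rcases Nat.eq_zero_or_pos ℓ with rfl | hℓ
    · exact h.eq_of_zero.2.le
    obtain ⟨x, c, hx, h0, h1, c0, rfl⟩ := h.exists_traj
    by_cases hinj : ∀ a b, a < b → b < ℓ → x a ≠ x b
    · refine (isCycle_map_range hx hℓ (h0.trans h1.symm) hinj).weight_nonpos hlam ?_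
      rw [weight_map_range hx, c0, sub_zero]
    · push Not at hinj
      obtain ⟨a, b, hab, hb, he⟩ := hinj
      have h₁ := hx.seg (Nat.zero_le a) (by omega)
      have h₂ := hx.seg hab.le (by omega)
      have h₃ := hx.seg hb.le le_rfl
      rw [h0] at h₁
      rw [← he] at h₂
      rw [← he, h1] at h₃
      have := ih _ (by omega) _ _ h₂
      have := ih _ (by omega) _ _ (h₁.trans h₃)
      linarith

theorem IsCycle.exists_rotate {W : List (Fin n)} (h : IsCycle (arc A) W) {z : Fin n}
    (hz : z ∈ W) : ∃ b, IsCycle (arc A) (z :: b ++ [z]) ∧ weight A (z :: b ++ [z]) = weight A W ∧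
      len (z :: b ++ [z]) = len W ∧ W.dropLast ~r z :: b := by
  obtain ⟨v, l, rfl⟩ := h.exists_eq
  have hdrop : (v :: l ++ [v]).dropLast = v :: l := List.dropLast_concat
  have hz' : z ∈ v :: l := by
    simp only [List.mem_append, List.mem_singleton] at hz
    rcases hz with hz | rfl
    · exact hz
    · exact List.mem_cons_self
  obtain ⟨a, b, hab⟩ := List.append_of_mem hz'
  cases a with
  | nil =>
    simp only [List.nil_append, List.cons.injEq] at hab
    obtain ⟨rfl, rfl⟩ := hab
    exact ⟨l, h, rfl, rfl, by rw [hdrop]⟩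
  | cons v' a =>
    simp only [List.cons_append, List.cons.injEq] at hab
    obtain ⟨rfl, rfl⟩ := hab
    have hw : weight A (z :: (b ++ v :: a) ++ [z]) = weight A (v :: (a ++ z :: b) ++ [v]) := by
      have h₁ := weight_append (A := A) (z :: b) v (a ++ [z])
      have h₂ := weight_append (A := A) (v :: a) z (b ++ [v])
      simp only [List.cons_append, List.append_assoc] at h₁ h₂ ⊢
      rw [h₁, h₂, add_comm]
    have hrot : (v :: (a ++ z :: b)) ~r (z :: (b ++ v :: a)) :=
      List.isRotated_append (l := v :: a) (l' := z :: b)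
    refine ⟨b ++ v :: a, ⟨by simp; omega, ?_, by rw [List.getLast?_concat]; rfl, ?_⟩,
      hw, ?_, by rw [hdrop]; exact hrot⟩
    · exact (chain_iff_weight_ne_bot _).2 (hw ▸ (chain_iff_weight_ne_bot _).1 h.2.1)
    · have := h.2.2.2
      rw [hdrop] at this
      rw [List.dropLast_concat]
      exact hrot.nodup_iff.1 this
    · simp [len]; omega

/-- A cycle through `z`, read from `z`, as a trajectory. -/
theorem IsCycle.exists_traj {W : List (Fin n)} (h : IsCycle (arc A) W) {z : Fin n}
    (hz : z ∈ W) : ∃ x c, Traj A x c (len W) ∧ x 0 = z ∧ x (len W) = z ∧ c 0 = 0 ∧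
      weight A W = ((c (len W) : ℝ) : Rmax) ∧ W.dropLast ~r (List.range (len W)).map x ∧
      ((List.range (len W)).map x).Nodup := by
  obtain ⟨b, hb, hw, hlen, hrot⟩ := h.exists_rotate hz
  obtain ⟨x, c, hx, hW, c0, hc⟩ := exists_traj_of_list (by simp) hb.2.1
  rw [hlen] at hx hW hc
  have hd := congrArg List.dropLast hW
  rw [dropLast_map_range, List.dropLast_concat] at hd
  refine ⟨x, c, hx, ?_, ?_, c0, hw ▸ hc, hd ▸ hrot, ?_⟩
  · have := congrArg List.head? hW
    simp [List.range_succ_eq_map] at this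
    exact this.symm
  · have := congrArg List.getLast? hW
    rw [List.getLast?_concat, List.range_succ, List.map_append] at this
    simp at this
    exact this.symm
  · have := hb.2.2.2
    rwa [List.dropLast_concat, hd] at this

theorem isChain_iff_zip_tail {R : Fin n → Fin n → Prop} (W : List (Fin n)) :
    W.IsChain R ↔ ∀ p ∈ W.zip W.tail, R p.1 p.2 := by
  induction W with
  | nil => simp
  | cons u W ih =>
    cases W with
    | nil => simp
    | cons v W =>
      rw [List.isChain_cons_cons, ih]
      simp

theorem mem_zip_tail_map_range {x : ℕ → Fin n} {ℓ : ℕ} {i j : Fin n}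
    (h : (i, j) ∈ ((List.range (ℓ + 1)).map x).zip ((List.range (ℓ + 1)).map x).tail) :
    ∃ p < ℓ, x p = i ∧ x (p + 1) = j := by
  obtain ⟨p, hp, he⟩ := List.mem_iff_getElem.1 h
  simp at hp he
  exact ⟨p, by omega, he.1, he.2⟩

end

section

variable {n : ℕ} {A : Mat n}

theorem head?_map_range (x : ℕ → Fin n) (ℓ : ℕ) :
    ((List.range (ℓ + 1)).map x).head? = some (x 0) := by
  simp [List.range_succ_eq_map]

theorem getLast?_map_range (x : ℕ → Fin n) (ℓ : ℕ) :
    ((List.range (ℓ + 1)).map x).getLast? = some (x ℓ) := by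
  simp [List.range_succ]

theorem IsWalkFrom.exists_traj {V : List (Fin n)} {i j : Fin n} (h : IsWalkFrom (arc A) V i j) :
    ∃ x c, Traj A x c (len V) ∧ V = (List.range (len V + 1)).map x ∧ x 0 = i ∧ x (len V) = j ∧
      c 0 = 0 ∧ weight A V = ((c (len V) : ℝ) : Rmax) := by
  obtain ⟨⟨hne, hch⟩, hi, hj⟩ := h
  obtain ⟨x, c, hx, hV, c0, hc⟩ := exists_traj_of_list hne hch
  rw [hV, head?_map_range] at hi
  rw [hV, getLast?_map_range] at hj
  exact ⟨x, c, hx, hV, Option.some_injective _ hi, Option.some_injective _ hj, c0, hc⟩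

/-- The restriction of `A` to its critical arcs. -/
def critMat (A : Mat n) : Mat n := fun i j => if critArc A i j then A i j else ⊥

theorem critMat_mono (i j : Fin n) (h : critMat A i j ≠ ⊥) : A i j = critMat A i j := by
  unfold critMat at h ⊢
  split_ifs at h ⊢ <;> simp_all

theorem critArc.ne_bot {i j : Fin n} (h : critArc A i j) : A i j ≠ ⊥ := by
  obtain ⟨W, hW, hij⟩ := h
  exact (isChain_iff_zip_tail W).1 hW.1.2.1 _ hij

theorem arc_critMat {i j : Fin n} : arc (critMat A) i j ↔ critArc A i j := by
  unfold arc critMat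
  split_ifs with h
  · simpa [h] using h.ne_bot
  · simpa using h

theorem critArc.critNode_left {i j : Fin n} (h : critArc A i j) : critNode A i := by
  obtain ⟨W, hW, hij⟩ := h
  exact ⟨W, hW, (List.of_mem_zip hij).1⟩

theorem critArc.critNode_right {i j : Fin n} (h : critArc A i j) : critNode A j := by
  obtain ⟨W, hW, hij⟩ := h
  exact ⟨W, hW, List.mem_of_mem_tail (List.of_mem_zip hij).2⟩

theorem isCycle_critMat {W : List (Fin n)} :
    IsCycle (arc (critMat A)) W ↔ IsCycle (critArc A) W := by
  have : arc (critMat A) = critArc A := by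
    ext i j; exact arc_critMat
  rw [this]

theorem IsCritCycle.isCycle_critArc {W : List (Fin n)} (h : IsCritCycle A W) :
    IsCycle (critArc A) W :=
  ⟨h.1.1, (isChain_iff_zip_tail W).2 fun _ hp => ⟨W, h, hp⟩, h.1.2.2⟩

theorem critNode_of_onCycle {i : Fin n} (h : onCycle (critArc A) i) : critNode A i := by
  obtain ⟨W, hW, hi⟩ := h
  have hW' := isCycle_critMat.2 hW
  obtain ⟨x, c, hx, rfl, -⟩ := hW'.exists_traj hi
  have h0 : 0 < len W := by have := hW.1; unfold len; omega
  exact (arc_critMat.1 (show critMat A (x 0) (x 1) ≠ ⊥ by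
    rw [hx 0 h0]; exact WithBot.coe_ne_bot)).critNode_left

/-- A critical cycle, read from one of its nodes. -/
theorem IsCritCycle.exists_traj (hlam : lam A = 0) {W : List (Fin n)} (h : IsCritCycle A W)
    {z : Fin n} (hz : z ∈ W) : ∃ x c, Traj (critMat A) x c (len W) ∧ x 0 = z ∧ x (len W) = z ∧
      c 0 = 0 ∧ c (len W) = 0 ∧ W.dropLast ~r (List.range (len W)).map x := by
  obtain ⟨x, c, hx, h0, h1, c0, hc, hrot, -⟩ :=
    (isCycle_critMat.2 h.isCycle_critArc).exists_traj hz
  refine ⟨x, c, hx, h0, h1, c0, ?_, hrot⟩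
  have : weight A W = weight (critMat A) W := by
    unfold weight
    congr 1
    refine List.map_congr_left fun p hp => ?_
    have : critArc A p.1 p.2 := ⟨W, h, hp⟩
    simp [critMat, this]
  rw [← this, h.weight_eq hlam] at hc
  exact_mod_cast hc.symm

theorem critArc.reach_reverse (hlam : lam A = 0) {i j : Fin n} (h : critArc A i j) {a : ℝ}
    (ha : A i j = (a : Rmax)) : ∃ ℓ, Reach A j i ℓ (-a) := by
  obtain ⟨W, hW, hij⟩ := h
  have hne : W ≠ [] := by rintro rfl; simp at hij
  obtain ⟨x, c, hx, hV, c0, hc⟩ := exists_traj_of_list hne hW.1.2.1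
  rw [hV] at hij
  obtain ⟨p, hp, rfl, rfl⟩ := mem_zip_tail_map_range hij
  have hcl := hW.1.2.2.1
  rw [hV, head?_map_range, getLast?_map_range, Option.some_inj] at hcl
  rw [hW.weight_eq hlam] at hc
  have hc : c (len W) = 0 := by exact_mod_cast hc.symm
  have h₁ := hx.seg (show p + 1 ≤ len W by omega) le_rfl
  have h₂ := hx.seg (Nat.zero_le p) hp.le
  rw [hcl] at h₂
  have ha' : c (p + 1) - c p = a := by
    rw [hx p hp] at ha
    exact_mod_cast ha
  exact ⟨_, (h₁.trans h₂).cast rfl (by rw [hc, c0, ← ha']; ring)⟩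

theorem Reach.reverse (hlam : lam A = 0) {i j : Fin n} {ℓ : ℕ} {w : ℝ}
    (h : Reach (critMat A) i j ℓ w) : ∃ ℓ', Reach A j i ℓ' (-w) := by
  induction h with
  | nil i => exact ⟨0, (Reach.nil i).cast rfl (by ring)⟩
  | @cons i k j a ℓ w ha _ ih =>
    obtain ⟨ℓ', h'⟩ := ih
    have hik : arc (critMat A) i k := by rw [arc, ha]; exact WithBot.coe_ne_bot
    obtain ⟨ℓ'', h''⟩ := (arc_critMat.1 hik).reach_reverse hlam
      ((critMat_mono _ _ hik).trans ha)
    exact ⟨_, (h'.trans h'').cast rfl (by ring)⟩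

theorem Reach.of_critMat {i j : Fin n} {ℓ : ℕ} {w : ℝ} (h : Reach (critMat A) i j ℓ w) :
    Reach A i j ℓ w := h.mono critMat_mono

theorem closed_critMat_eq_zero (hlam : lam A = 0) {v : Fin n} {ℓ : ℕ} {w : ℝ}
    (h : Reach (critMat A) v v ℓ w) : w = 0 := by
  obtain ⟨ℓ', h'⟩ := h.reverse hlam
  have h₁ := closed_nonpos hlam _ _ _ h.of_critMat
  have h₂ := closed_nonpos hlam _ _ _ h'
  linarith

theorem exists_reach_critMat {i j : Fin n} (h : reach (critArc A) i j) :
    ∃ ℓ w, Reach (critMat A) i j ℓ w := by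
  obtain ⟨V, ⟨hne, hV⟩, hi, hj⟩ := h
  have hV' : IsWalkFrom (arc (critMat A)) V i j :=
    ⟨⟨hne, List.IsChain.imp (fun _ _ h => arc_critMat.2 h) hV⟩, hi, hj⟩
  obtain ⟨x, c, hx, -, rfl, rfl, -⟩ := hV'.exists_traj
  exact ⟨_, _, hx.seg (Nat.zero_le _) le_rfl⟩

theorem Reach.critNode_right {i j : Fin n} {ℓ : ℕ} {w : ℝ} (h : Reach (critMat A) i j ℓ w)
    (hi : critNode A i) : critNode A j := by
  induction h with
  | nil i => exact hi
  | @cons i k j a ℓ w ha _ ih =>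
    have hik : arc (critMat A) i k := by rw [arc, ha]; exact WithBot.coe_ne_bot
    exact ih (arc_critMat.1 hik).critNode_right

/-- The cyclicity of a digraph with only one strongly connected component containing cycles is the
greatest common divisor of all cycle lengths. -/
theorem cyclicity_spec {R : Fin n → Fin n → Prop}
    (hR : ∀ i j, onCycle R i → onCycle R j → reach R i j) {Z : List (Fin n)} (hZ : IsCycle R Z) :
    (∀ W, IsCycle R W → cyclicity R ∣ len W) ∧
      ∀ d, (∀ W, IsCycle R W → d ∣ len W) → d ∣ cyclicity R := by
  set D : Set ℕ := {d | ∀ W, IsCycle R W → d ∣ len W} with hD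
  have hpos : 0 < len Z := by have := hZ.1; unfold len; omega
  have hmem : ∃ v, v ∈ Z := by
    have := hZ.1
    exact ⟨_, List.getElem_mem (show 0 < Z.length by omega)⟩
  obtain ⟨v, hv⟩ := hmem
  have hscc : ∀ i, onCycle R i → sccGcd R i = sSup D := by
    intro i hi
    unfold sccGcd
    congr 1
    ext d
    refine ⟨fun h W hW => ?_, fun h W hW _ => h W hW⟩
    have : 0 < W.length := by have := hW.1; omega
    have hu : W[0] ∈ W := List.getElem_mem this
    exact h W hW ⟨_, hu, hR _ _ hi ⟨W, hW, hu⟩, hR _ _ ⟨W, hW, hu⟩ hi⟩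
  have hcyc : cyclicity R = sSup D := by
    refine Nat.dvd_antisymm ?_ ?_
    · refine Finset.lcm_dvd fun i hi => ?_
      rw [hscc i (Finset.mem_filter.1 hi).2]
    · rw [← hscc v ⟨Z, hZ, hv⟩]
      exact Finset.dvd_lcm (f := sccGcd R)
        (Finset.mem_filter.2 ⟨Finset.mem_univ v, ⟨Z, hZ, hv⟩⟩)
  have hbdd : BddAbove D := ⟨len Z, fun d hd => Nat.le_of_dvd hpos (hd Z hZ)⟩
  have hsup : sSup D ∈ D := Nat.sSup_mem ⟨1, fun W _ => one_dvd _⟩ hbdd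
  rw [hcyc]
  refine ⟨hsup, fun d hd => ?_⟩
  have hl : Nat.lcm d (sSup D) ∈ D := fun W hW => Nat.lcm_dvd (hd W hW) (hsup W hW)
  have h₁ := le_csSup hbdd hl
  have h₂ : 0 < sSup D := Nat.pos_of_dvd_of_pos (hsup Z hZ) hpos
  have h₃ := Nat.le_antisymm h₁ (Nat.le_of_dvd (Nat.pos_of_dvd_of_pos (Nat.lcm_dvd (hd Z hZ)
    (hsup Z hZ)) hpos) (Nat.dvd_lcm_right d _))
  rw [← h₃]
  exact Nat.dvd_lcm_left _ _

end

section

variable {n : ℕ} {A : Mat n}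

theorem Reach.split {i j : Fin n} {a b : ℕ} {w : ℝ} (h : Reach A i j (a + b) w) :
    ∃ k w₁ w₂, Reach A i k a w₁ ∧ Reach A k j b w₂ ∧ w = w₁ + w₂ := by
  obtain ⟨x, c, hx, rfl, rfl, c0, rfl⟩ := h.exists_traj
  exact ⟨x a, _, _, hx.seg (Nat.zero_le a) (by omega),
    (hx.seg (show a ≤ a + b by omega) le_rfl).cast (by omega) rfl, by rw [c0]; ring⟩

/-- The residues modulo `g` of the lengths of the closed walks of weight zero at `z`. -/
def zeroLengths (A : Mat n) (z : Fin n) (g : ℕ) (hg : 0 < g) : AddSubgroup ℤ where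
  carrier := {k | ∃ ℓ : ℕ, Reach A z z ℓ 0 ∧ (g : ℤ) ∣ ℓ - k}
  zero_mem' := ⟨0, .nil z, by simp⟩
  add_mem' := by
    rintro k k' ⟨ℓ, h, e, hd⟩ ⟨ℓ', h', e', hd'⟩
    refine ⟨ℓ + ℓ', (h.trans h').cast rfl (by ring), e + e', ?_⟩
    push_cast
    linear_combination hd + hd'
  neg_mem' := by
    rintro k ⟨ℓ, h, e, hd⟩
    obtain ⟨m, rfl⟩ : ∃ m, g = m + 1 := ⟨g - 1, by omega⟩
    refine ⟨ℓ * m, h.repeat_closed m, ℓ - e, ?_⟩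
    push_cast at hd ⊢
    linear_combination -hd

theorem mem_zeroLengths {z : Fin n} {g : ℕ} (hg : 0 < g) {ℓ : ℕ} (h : Reach A z z ℓ 0) :
    (ℓ : ℤ) ∈ zeroLengths A z g hg := ⟨ℓ, h, by simp⟩

theorem cyclicity_critArc_spec
    (hSC : ∀ i j, critNode A i → critNode A j → reach (critArc A) i j)
    {Z : List (Fin n)} (hZ : IsCritCycle A Z) :
    (∀ W, IsCycle (critArc A) W → cyclicity (critArc A) ∣ len W) ∧
      ∀ d, (∀ W, IsCycle (critArc A) W → d ∣ len W) → d ∣ cyclicity (critArc A) :=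
  cyclicity_spec (fun i j hi hj => hSC i j (critNode_of_onCycle hi) (critNode_of_onCycle hj))
    hZ.isCycle_critArc

theorem cyclicity_mem_zeroLengths (hlam : lam A = 0)
    (hSC : ∀ i j, critNode A i → critNode A j → reach (critArc A) i j)
    {Z : List (Fin n)} (hZ : IsCritCycle A Z) {z : Fin n} (hz : z ∈ Z) {g : ℕ} (hg : 0 < g) :
    (cyclicity (critArc A) : ℤ) ∈ zeroLengths A z g hg := by
  have hzc : critNode A z := ⟨Z, hZ, hz⟩
  obtain ⟨d, hd⟩ := Int.subgroup_cyclic (zeroLengths A z g hg)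
  have hmem : ∀ k : ℤ, k ∈ zeroLengths A z g hg ↔ d ∣ k := by
    intro k
    rw [hd, AddSubgroup.mem_closure_singleton]
    constructor
    · rintro ⟨m, rfl⟩
      simp
    · rintro ⟨m, rfl⟩
      exact ⟨m, by simp [mul_comm]⟩
  rw [hmem, ← Int.natAbs_dvd_natAbs, Int.natAbs_natCast]
  refine (cyclicity_critArc_spec hSC hZ).2 _ fun W hW => ?_
  rw [← Int.natAbs_natCast (len W), Int.natAbs_dvd_natAbs, ← hmem]
  have hpos : 0 < W.length := by have := hW.1; omega
  have hv : W[0] ∈ W := List.getElem_mem hpos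
  have hvc : critNode A W[0] := critNode_of_onCycle ⟨W, hW, hv⟩
  obtain ⟨x, c, hx, h0, h1, c0, -⟩ := (isCycle_critMat.2 hW).exists_traj hv
  have hvv := hx.seg (Nat.zero_le _) le_rfl
  rw [h0, h1] at hvv
  obtain ⟨a, w₁, h₁⟩ := exists_reach_critMat (hSC _ _ hzc hvc)
  obtain ⟨b, w₂, h₂⟩ := exists_reach_critMat (hSC _ _ hvc hzc)
  have e₁ := closed_critMat_eq_zero hlam (h₁.trans h₂)
  have e₂ := closed_critMat_eq_zero hlam ((h₁.trans hvv).trans h₂)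
  have m₁ := mem_zeroLengths hg ((h₁.trans h₂).of_critMat.cast rfl e₁)
  have m₂ := mem_zeroLengths hg (((h₁.trans hvv).trans h₂).of_critMat.cast rfl e₂)
  have := sub_mem m₂ m₁
  rw [Nat.sub_zero] at this
  push_cast at this
  rwa [show (len W : ℤ) = a + len W + b - (a + b) by ring]

theorem le_pow_pow {γ : ℕ} {i j : Fin n} {k : ℕ} {w : ℝ} (h : Reach A i j (γ * k) w) :
    (w : Rmax) ≤ pow (pow A γ) k i j := by
  induction k generalizing i w with
  | zero =>
    have : (w : Rmax) ≤ pow A 0 i j := le_pow (h.cast (Nat.mul_zero γ) rfl)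
    exact this
  | succ k ih =>
    obtain ⟨u, w₁, w₂, h₁, h₂, rfl⟩ := (h.cast (show γ * (k + 1) = γ + γ * k by ring) rfl).split
    exact le_mul (le_pow h₁) (ih h₂)

theorem Reach.of_pow {γ : ℕ} {i j : Fin n} {k : ℕ} {w : ℝ} (h : Reach (pow A γ) i j k w) :
    Reach A i j (γ * k) w := by
  induction h with
  | nil i => exact .nil i
  | cons ha _ ih => exact ((reach_of_pow ha).trans ih).cast (by ring) rfl

theorem le_star (hlam : lam A = 0) {γ : ℕ} (hγ : 0 < γ) {i j : Fin n} {ℓ : ℕ} {w : ℝ}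
    (h : Reach A i j ℓ w) (hd : γ ∣ ℓ) : (w : Rmax) ≤ star (pow A γ) i j := by
  obtain ⟨ℓ', w', h', hlt, hm, hw⟩ := h.shrink (closed_nonpos hlam) hγ
  obtain ⟨k, rfl⟩ : γ ∣ ℓ' := (Nat.modEq_zero_iff_dvd).1
    (hm.trans ((Nat.modEq_zero_iff_dvd).2 hd))
  have hk : k < n := lt_of_mul_lt_mul_left hlt (Nat.zero_le _)
  calc (w : Rmax) ≤ (w' : Rmax) := by exact_mod_cast hw
    _ ≤ pow (pow A γ) k i j := le_pow_pow h'
    _ ≤ star (pow A γ) i j :=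
      Finset.le_sup (f := fun k => pow (pow A γ) k i j) (Finset.mem_range.2 hk)

theorem reach_of_star {γ : ℕ} {i j : Fin n} {w : ℝ} (h : star (pow A γ) i j = (w : Rmax)) :
    ∃ k, Reach A i j (γ * k) w := by
  have hn : (Finset.range n).Nonempty := ⟨i, Finset.mem_range.2 i.2⟩
  obtain ⟨k, -, hk⟩ := Finset.exists_mem_eq_sup _ hn fun k => pow (pow A γ) k i j
  exact ⟨k, (reach_of_pow (hk.symm.trans h)).of_pow⟩

theorem csr_eq (hlam : lam A = 0) (t : ℕ) : csr A t =
    mul (fun i j => if critNode A j then star (pow A (cyclicity (critArc A))) i j else ⊥)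
      (mul (pow (critMat A) t)
        fun i j => if critNode A i then star (pow A (cyclicity (critArc A))) i j else ⊥) := by
  have h₁ : lam A ≠ ⊥ := by rw [hlam]; exact WithBot.coe_ne_bot
  have h₂ : smul (negB (lam A)) A = A := by
    have : negB 0 = 0 := by
      change ((-0 : ℝ) : Rmax) = ((0 : ℝ) : Rmax)
      rw [neg_zero]
    ext i j : 2
    rw [hlam, smul, this, zero_add]
  unfold csr
  rw [if_neg h₁, h₂]
  rfl

theorem le_csr (hlam : lam A = 0)
    (hSC : ∀ i j, critNode A i → critNode A j → reach (critArc A) i j) {i u j : Fin n}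
    {ℓ₁ ℓ₂ : ℕ} {w₁ w₂ : ℝ} (h₁ : Reach A i u ℓ₁ w₁) (h₂ : Reach A u j ℓ₂ w₂)
    (hu : critNode A u) : ((w₁ + w₂ : ℝ) : Rmax) ≤ csr A (ℓ₁ + ℓ₂) i j := by
  set γ := cyclicity (critArc A) with hγ
  obtain ⟨W, hW, huW⟩ := hu
  have hu : critNode A u := ⟨W, hW, huW⟩
  obtain ⟨e, he⟩ := (cyclicity_critArc_spec hSC hW).1 W hW.isCycle_critArc
  rw [← hγ] at he
  have hpos : 0 < len W := by have := hW.1.1; unfold len; omega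
  have hγ0 : 0 < γ := Nat.pos_of_ne_zero fun h0 => by rw [h0] at he; omega
  obtain ⟨m, hm⟩ : ∃ m, γ = m + 1 := ⟨γ - 1, by omega⟩
  obtain ⟨x, c, hx, h0, h1, c0, c1, -⟩ := hW.exists_traj hlam huW
  have huu := (hx.seg (Nat.zero_le _) le_rfl)
  rw [h0, h1, c0, c1, Nat.sub_zero, sub_zero] at huu
  set t := ℓ₁ + ℓ₂ with ht
  obtain ⟨r, hr⟩ : ∃ r, len W * (ℓ₁ * m + t) = ℓ₁ * m + (t + r) := by
    refine ⟨len W * (ℓ₁ * m + t) - (ℓ₁ * m + t), ?_⟩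
    have := Nat.le_mul_of_pos_left (ℓ₁ * m + t) hpos
    omega
  obtain ⟨u', b₁, b₂, hb₁, hb₂, hb⟩ :=
    ((huu.repeat_closed (ℓ₁ * m + t)).cast hr rfl).split
  obtain ⟨v', b₃, b₄, hb₃, hb₄, rfl⟩ := hb₂.split
  have hu' := hb₁.critNode_right hu
  have hv' := hb₃.critNode_right hu'
  have s₁ := le_star hlam hγ0 (h₁.trans hb₁.of_critMat) ⟨ℓ₁, by rw [hm]; ring⟩
  have hdr : γ ∣ r + ℓ₂ := by
    refine (Nat.dvd_add_right (show γ ∣ γ * ℓ₁ from dvd_mul_right _ _)).1 ?_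
    have : γ * ℓ₁ + (r + ℓ₂) = γ * (e * (ℓ₁ * m + t)) := by
      rw [← mul_assoc, ← he, hr, hm, ht]; ring
    rw [this]
    exact dvd_mul_right _ _
  have s₂ := le_star hlam hγ0 (hb₄.of_critMat.trans h₂) hdr
  rw [csr_eq hlam]
  have : w₁ + w₂ = (w₁ + b₁) + (b₃ + (b₄ + w₂)) := by linarith
  rw [this]
  refine le_mul (k := u') ?_ (le_mul (k := v') (le_pow hb₃) ?_)
  · rw [if_pos hu']; exact s₁
  · rw [if_pos hv']; exact s₂

theorem exists_of_csr_eq (hlam : lam A = 0)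
    (hSC : ∀ i j, critNode A i → critNode A j → reach (critArc A) i j)
    {Z : List (Fin n)} (hZ : IsCritCycle A Z) {z : Fin n} (hz : z ∈ Z) {g : ℕ} (hg : 0 < g)
    {i j : Fin n} {t : ℕ} {w : ℝ} (h : csr A t i j = (w : Rmax)) :
    ∃ ℓ₁ ℓ₂ w₁ w₂, Reach A i z ℓ₁ w₁ ∧ Reach A z j ℓ₂ w₂ ∧ w = w₁ + w₂ ∧
      ℓ₁ + ℓ₂ ≡ t [MOD g] := by
  have hzc : critNode A z := ⟨Z, hZ, hz⟩
  rw [csr_eq hlam] at h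
  set γ := cyclicity (critArc A) with hγ
  obtain ⟨u, a, b', ha, hb', rfl⟩ := exists_of_mul_eq h
  obtain ⟨v, b, d, hb, hd, rfl⟩ := exists_of_mul_eq hb'
  split_ifs at ha hd with hu hv
  · obtain ⟨k₁, h₁⟩ := reach_of_star ha
    obtain ⟨k₂, h₂⟩ := reach_of_star hd
    have hb := reach_of_pow hb
    obtain ⟨p, e₁, q₁⟩ := exists_reach_critMat (hSC _ _ hu hzc)
    obtain ⟨q, e₂, q₂⟩ := exists_reach_critMat (hSC _ _ hzc hu)
    have he := closed_critMat_eq_zero hlam (q₁.trans q₂)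
    have m₁ := mem_zeroLengths hg ((q₂.trans q₁).of_critMat.cast rfl (show _ = 0 by linarith))
    have m₂ := cyclicity_mem_zeroLengths hlam hSC hZ hz hg
    have m₃ := neg_mem (add_mem (zsmul_mem m₂ (k₁ + k₂ : ℤ)) m₁)
    obtain ⟨s, hs, e, hgs⟩ := m₃
    refine ⟨_, _, _, _, h₁.trans (q₁.of_critMat.trans hs), q₂.of_critMat.trans
      (hb.of_critMat.trans h₂), by linarith, ?_⟩
    refine (Nat.modEq_iff_dvd).2 ?_
    refine ⟨-e, ?_⟩
    rw [smul_eq_mul, ← hγ] at hgs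
    push_cast at hgs ⊢
    linear_combination -hgs
  all_goals first
    | exact absurd ha.symm WithBot.coe_ne_bot
    | exact absurd hd.symm WithBot.coe_ne_bot

end

section

variable {n : ℕ} {A : Mat n}

theorem Reach.bN_or_through {i j : Fin n} {ℓ : ℕ} {w : ℝ} (h : Reach A i j ℓ w) :
    Reach (bN A) i j ℓ w ∨ ∃ u ℓ₁ ℓ₂ w₁ w₂, critNode A u ∧ Reach A i u ℓ₁ w₁ ∧
      Reach A u j ℓ₂ w₂ ∧ ℓ₁ + ℓ₂ = ℓ ∧ w₁ + w₂ = w := by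
  induction h with
  | nil i => exact .inl (.nil i)
  | @cons i k j a ℓ w ha h ih =>
    by_cases hi : critNode A i
    · exact .inr ⟨i, 0, _, 0, _, hi, .nil i, .cons ha h, by omega, by ring⟩
    by_cases hk : critNode A k
    · exact .inr ⟨k, 1, ℓ, a, w, hk, .single ha, h, by omega, rfl⟩
    rcases ih with h' | ⟨u, ℓ₁, ℓ₂, w₁, w₂, hu, h₁, h₂, rfl, rfl⟩
    · exact .inl (.cons (by simp [bN, hi, hk, ha]) h')
    · exact .inr ⟨u, _, _, _, _, hu, .cons ha h₁, h₂, by omega, by ring⟩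

theorem bN_mono (i j : Fin n) (h : bN A i j ≠ ⊥) : A i j = bN A i j := by
  unfold bN at h ⊢
  split_ifs at h ⊢ <;> simp_all

theorem pow_le_oplus (hlam : lam A = 0)
    (hSC : ∀ i j, critNode A i → critNode A j → reach (critArc A) i j) (t : ℕ) (i j : Fin n) :
    pow A t i j ≤ oplus (csr A t) (pow (bN A) t) i j := by
  rcases eq_or_ne (pow A t i j) ⊥ with h | h
  · rw [h]; exact bot_le
  obtain ⟨w, hw⟩ := WithBot.ne_bot_iff_exists.1 h
  rw [← hw]
  rcases (reach_of_pow hw.symm).bN_or_through with h' | ⟨u, ℓ₁, ℓ₂, w₁, w₂, hu, h₁, h₂, rfl, rfl⟩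
  · exact (le_pow h').trans (le_max_right _ _)
  · exact (le_csr hlam hSC h₁ h₂ hu).trans (le_max_left _ _)

theorem pow_bN_le (t : ℕ) (i j : Fin n) : pow (bN A) t i j ≤ pow A t i j := by
  rcases eq_or_ne (pow (bN A) t i j) ⊥ with h | h
  · rw [h]; exact bot_le
  obtain ⟨w, hw⟩ := WithBot.ne_bot_iff_exists.1 h
  rw [← hw]
  exact le_pow ((reach_of_pow hw.symm).mono bN_mono)

/-- Just below the weak CSR threshold, some entry of the CSR term exceeds the corresponding entry of
the power of `A`. -/
theorem exists_csr_gt (hlam : lam A = 0)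
    (hSC : ∀ i j, critNode A i → critNode A j → reach (critArc A) i j) (hT : 0 < T1 A) :
    ∃ i j w, csr A (T1 A - 1) i j = ((w : ℝ) : Rmax) ∧
      ∀ w', Reach A i j (T1 A - 1) w' → w' < w := by
  set S := {T | ∀ t, T ≤ t → pow A t = oplus (csr A t) (pow (bN A) t)} with hS
  have hmem : T1 A ∈ S := Nat.sInf_mem (Nat.nonempty_of_pos_sInf hT)
  have hnot : T1 A - 1 ∉ S := Nat.notMem_of_lt_sInf (show T1 A - 1 < T1 A by omega)
  have hneq : pow A (T1 A - 1) ≠ oplus (csr A (T1 A - 1)) (pow (bN A) (T1 A - 1)) := by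
    intro he
    refine hnot fun t ht => ?_
    rcases ht.eq_or_lt with rfl | hlt
    · exact he
    · exact hmem t (by omega)
  obtain ⟨i, hi⟩ := Function.ne_iff.1 hneq
  obtain ⟨j, hij⟩ := Function.ne_iff.1 hi
  have hlt : pow A (T1 A - 1) i j < csr A (T1 A - 1) i j := by
    by_contra! hle
    exact hij (le_antisymm (pow_le_oplus hlam hSC _ i j) (max_le hle (pow_bN_le _ i j)))
  obtain ⟨w, hw⟩ := WithBot.ne_bot_iff_exists.1 (bot_le.trans_lt hlt).ne'
  refine ⟨i, j, w, hw.symm, fun w' h' => ?_⟩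
  have := (le_pow h').trans_lt hlt
  rw [← hw] at this
  exact_mod_cast this

/-- There is a walk from `i` to `j` through `Z` of length `ℓ` and weight `w`. -/
def Through (A : Mat n) (Z : Finset (Fin n)) (i j : Fin n) (ℓ : ℕ) (w : ℝ) : Prop :=
  ∃ z ∈ Z, ∃ ℓ₁ ℓ₂ w₁ w₂, Reach A i z ℓ₁ w₁ ∧ Reach A z j ℓ₂ w₂ ∧ ℓ₁ + ℓ₂ = ℓ ∧ w₁ + w₂ = w

theorem Through.exists_max (hlam : lam A = 0) {Z : Finset (Fin n)} {g : ℕ} (hg : 0 < g)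
    {i j : Fin n} {t ℓ : ℕ} {w : ℝ} (h : Through A Z i j ℓ w) (hm : ℓ ≡ t [MOD g]) :
    ∃ L M, Through A Z i j L M ∧ L ≡ t [MOD g] ∧
      ∀ ℓ w, Through A Z i j ℓ w → ℓ ≡ t [MOD g] → w ≤ M := by
  set s := (Z ×ˢ Finset.range (g * n) ×ˢ Finset.range (g * n)).filter fun p =>
    p.2.1 + p.2.2 ≡ t [MOD g] ∧ pow A p.2.1 i p.1 ≠ ⊥ ∧ pow A p.2.2 p.1 j ≠ ⊥ with hs
  set F : Fin n × ℕ × ℕ → Rmax := fun p => pow A p.2.1 i p.1 + pow A p.2.2 p.1 j with hF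
  have key : ∀ ℓ w, Through A Z i j ℓ w → ℓ ≡ t [MOD g] → ∃ p ∈ s, (w : Rmax) ≤ F p := by
    rintro _ _ ⟨z, hz, ℓ₁, ℓ₂, w₁, w₂, h₁, h₂, rfl, rfl⟩ hmod
    obtain ⟨ℓ₁', w₁', h₁', hlt₁, hm₁, hw₁⟩ := h₁.shrink (closed_nonpos hlam) hg
    obtain ⟨ℓ₂', w₂', h₂', hlt₂, hm₂, hw₂⟩ := h₂.shrink (closed_nonpos hlam) hg
    have p₁ := le_pow h₁'
    have p₂ := le_pow h₂'
    refine ⟨(z, ℓ₁', ℓ₂'), ?_, ?_⟩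
    · simp only [hs, Finset.mem_filter, Finset.mem_product, Finset.mem_range]
      exact ⟨⟨hz, hlt₁, hlt₂⟩, (hm₁.add hm₂).trans hmod,
        ((WithBot.bot_lt_coe w₁').trans_le p₁).ne', ((WithBot.bot_lt_coe w₂').trans_le p₂).ne'⟩
    · calc ((w₁ + w₂ : ℝ) : Rmax) ≤ ((w₁' + w₂' : ℝ) : Rmax) := by
            exact_mod_cast add_le_add hw₁ hw₂
        _ = (w₁' : Rmax) + (w₂' : Rmax) := WithBot.coe_add _ _
        _ ≤ _ := by simp only [hF]; gcongr
  obtain ⟨p₀, hp₀, -⟩ := key _ _ h hm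
  obtain ⟨⟨z, ℓ₁, ℓ₂⟩, hp, hmax⟩ := Finset.exists_max_image s F ⟨p₀, hp₀⟩
  simp only [hs, Finset.mem_filter, Finset.mem_product, Finset.mem_range] at hp
  obtain ⟨⟨hz, -, -⟩, hmod, hb₁, hb₂⟩ := hp
  obtain ⟨w₁, hw₁⟩ := WithBot.ne_bot_iff_exists.1 hb₁
  obtain ⟨w₂, hw₂⟩ := WithBot.ne_bot_iff_exists.1 hb₂
  refine ⟨ℓ₁ + ℓ₂, w₁ + w₂, ⟨z, hz, ℓ₁, ℓ₂, w₁, w₂, reach_of_pow hw₁.symm, reach_of_pow hw₂.symm,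
    rfl, rfl⟩, hmod, fun ℓ w h hm => ?_⟩
  obtain ⟨p, hp, hle⟩ := key _ _ h hm
  have := hle.trans (hmax p hp)
  simp only [hF, ← hw₁, ← hw₂] at this
  exact_mod_cast this

theorem Reach.exists_traj_append {i z j : Fin n} {ℓ₁ ℓ₂ : ℕ} {w₁ w₂ : ℝ} (h₁ : Reach A i z ℓ₁ w₁)
    (h₂ : Reach A z j ℓ₂ w₂) : ∃ x c, Traj A x c (ℓ₁ + ℓ₂) ∧ x 0 = i ∧ x ℓ₁ = z ∧
      x (ℓ₁ + ℓ₂) = j ∧ c 0 = 0 ∧ c (ℓ₁ + ℓ₂) = w₁ + w₂ := by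
  obtain ⟨x, c, hx, h0, h1, c0, c1⟩ := h₁.exists_traj
  obtain ⟨y, d, hy, k0, k1, d0, d1⟩ := h₂.exists_traj
  refine ⟨fun k => if k ≤ ℓ₁ then x k else y (k - ℓ₁),
    fun k => if k ≤ ℓ₁ then c k else w₁ + d (k - ℓ₁), ?_, by simp [h0], by simp [h1], ?_,
    by simp [c0], ?_⟩
  · intro k hk
    rcases lt_trichotomy k ℓ₁ with hlt | rfl | hlt
    · simp [hlt.le, show k + 1 ≤ ℓ₁ by omega, hx k hlt]
    · have := hy 0 (by omega)
      simp only [le_refl, if_true, show ¬ k + 1 ≤ k by omega, if_false, h1, ← k0, c1,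
        show k + 1 - k = 0 + 1 by omega, this]
      rw [d0]
      congr 1
      ring
    · have := hy (k - ℓ₁) (by omega)
      simp only [show ¬ k ≤ ℓ₁ by omega, show ¬ k + 1 ≤ ℓ₁ by omega, if_false,
        show k + 1 - ℓ₁ = k - ℓ₁ + 1 by omega, this]
      congr 1
      ring
  · rcases Nat.eq_zero_or_pos ℓ₂ with rfl | hpos
    · simp [h1, ← k1, k0]
    · simp [show ¬ ℓ₂ = 0 by omega, k1]
  · rcases Nat.eq_zero_or_pos ℓ₂ with rfl | hpos
    · simp [c1, ← d1, d0]
    · simp [show ¬ ℓ₂ = 0 by omega, d1]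

theorem Through.exists_config (hlam : lam A = 0) {Z : Finset (Fin n)} {g : ℕ} (hg : 0 < g)
    {i j : Fin n} {t ℓ : ℕ} {w : ℝ} (h : Through A Z i j ℓ w) (hm : ℓ ≡ t [MOD g]) :
    ∃ x c f L, Config A Z g x c f L ∧ x 0 = i ∧ x L = j ∧ c 0 = 0 ∧ L ≡ t [MOD g] ∧
      ∀ ℓ w, Through A Z i j ℓ w → ℓ ≡ t [MOD g] → w ≤ c L := by
  obtain ⟨L₀, M, hL₀, hm₀, hmax⟩ := h.exists_max hlam hg hm
  have hex : ∃ L, Through A Z i j L M ∧ L ≡ t [MOD g] := ⟨L₀, hL₀, hm₀⟩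
  obtain ⟨hL, hmL⟩ := Nat.find_spec hex
  have hLmin : ∀ {L'}, _ → Nat.find hex ≤ L' := fun h => Nat.find_min' hex h
  generalize Nat.find hex = L at hL hmL hLmin
  have hex' : ∃ f, ∃ z ∈ Z, ∃ ℓ₂ w₁ w₂, Reach A i z f w₁ ∧ Reach A z j ℓ₂ w₂ ∧ f + ℓ₂ = L ∧
      w₁ + w₂ = M := by
    obtain ⟨z, hz, f, ℓ₂, w₁, w₂, h⟩ := hL
    exact ⟨f, z, hz, ℓ₂, w₁, w₂, h⟩
  obtain ⟨z, hz, ℓ₂, w₁, w₂, h₁, h₂, hf, hM⟩ := Nat.find_spec hex'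
  have hfmin : ∀ {f'}, _ → Nat.find hex' ≤ f' := fun h => Nat.find_min' hex' h
  generalize Nat.find hex' = f at h₁ hf hfmin
  subst hf
  obtain ⟨x, c, hx, rfl, rfl, rfl, c0, c1⟩ := h₁.exists_traj_append h₂
  refine ⟨x, c, f, f + ℓ₂, ⟨hx, by omega, hz, closed_nonpos hlam, ?_, ?_⟩, rfl, rfl, c0, hmL, ?_⟩
  · intro z hz ℓ₁ ℓ₂ w₁ w₂ r₁ r₂ hmod hw
    have hT : Through A Z (x 0) (x _) _ _ := ⟨z, hz, _, _, _, _, r₁, r₂, rfl, rfl⟩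
    have hmod' := hmod.trans hmL
    have := hmax _ _ hT hmod'
    have he : w₁ + w₂ = M := by linarith
    exact hLmin ⟨he ▸ hT, hmod'⟩
  · intro z hz ℓ₁ ℓ₂ w₁ w₂ r₁ r₂ hlen hw
    have := hmax _ _ ⟨z, hz, _, _, _, _, r₁, r₂, rfl, rfl⟩ (hlen ▸ hmL)
    exact hfmin ⟨z, hz, _, _, _, r₁, r₂, hlen, by linarith⟩
  · rw [c1, hM]
    exact hmax

section

variable {Z₀ : List (Fin n)}

theorem IsCycle.mem_dropLast {R : Fin n → Fin n → Prop} (h : IsCycle R Z₀) {v : Fin n} :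
    v ∈ Z₀.dropLast ↔ v ∈ Z₀ := by
  obtain ⟨u, l, rfl⟩ := h.exists_eq
  rw [List.dropLast_concat]
  simp only [List.mem_append, List.mem_cons, List.not_mem_nil]
  tauto

theorem IsCycle.card_toFinset {R : Fin n → Fin n → Prop} (h : IsCycle R Z₀) :
    Z₀.dropLast.toFinset.card = len Z₀ := by
  rw [List.toFinset_card_of_nodup h.2.2.2, List.length_dropLast, len]

theorem IsCritCycle.exists_reach (hlam : lam A = 0) (h : IsCritCycle A Z₀) {z u : Fin n}
    (hz : z ∈ Z₀) (hu : u ∈ Z₀) :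
    ∃ ℓ₁ ℓ₂ a, ℓ₁ + ℓ₂ = len Z₀ ∧ Reach A z u ℓ₁ a ∧ Reach A u z ℓ₂ (-a) := by
  obtain ⟨x, c, hx, h0, h1, c0, c1, hrot⟩ := h.exists_traj hlam hz
  obtain ⟨p, hp, rfl⟩ := List.mem_map.1 (hrot.mem_iff.1 (h.1.mem_dropLast.2 hu))
  rw [List.mem_range] at hp
  have r₁ := (hx.seg (Nat.zero_le p) hp.le).of_critMat
  have r₂ := (hx.seg hp.le le_rfl).of_critMat
  rw [h0] at r₁
  rw [h1] at r₂
  exact ⟨p, len Z₀ - p, c p, by omega, r₁.cast (by omega) (by rw [c0]; ring),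
    r₂.cast rfl (by rw [c1]; ring)⟩

theorem IsCritCycle.reach_self (hlam : lam A = 0) (h : IsCritCycle A Z₀) {z : Fin n}
    (hz : z ∈ Z₀) : Reach A z z (len Z₀) 0 := by
  obtain ⟨x, c, hx, h0, h1, c0, c1, -⟩ := h.exists_traj hlam hz
  have := (hx.seg (Nat.zero_le _) le_rfl).of_critMat
  rw [h0, h1] at this
  exact this.cast (by omega) (by rw [c0, c1]; ring)

theorem exists_config {g : ℕ} (hg : 2 ≤ g) (hlam : lam A = 0) (hT : T1 A = DM g n)
    (hZ₀ : IsCritCycle A Z₀) (hlen : len Z₀ = g)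
    (hSC : ∀ i j, critNode A i → critNode A j → reach (critArc A) i j) :
    ∃ x c f L, Config A Z₀.dropLast.toFinset g x c f L ∧ g * n + n ≤ L + 1 + g ∧ c 0 = 0 ∧
      ∀ ℓ w, Through A Z₀.dropLast.toFinset (x 0) (x L) ℓ w → ℓ ≡ L [MOD g] → w ≤ c L := by
  have hgn : g ≤ n := by
    have := Finset.card_le_univ Z₀.dropLast.toFinset
    rwa [hZ₀.1.card_toFinset, hlen, Fintype.card_fin] at this
  obtain ⟨m, rfl⟩ : ∃ m, n = m + 2 := ⟨n - 2, by omega⟩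
  have hDM : T1 A = g * m + (m + 2) := hT
  obtain ⟨i, j, w, hw, hlt⟩ := exists_csr_gt hlam hSC (by omega)
  have hz : ∃ z, z ∈ Z₀ := by
    have := hZ₀.1.1
    exact ⟨_, List.getElem_mem (show 0 < Z₀.length by omega)⟩
  obtain ⟨z, hz⟩ := hz
  have hzZ : ∀ v, v ∈ Z₀.dropLast.toFinset ↔ v ∈ Z₀ := fun v => by
    rw [List.mem_toFinset, hZ₀.1.mem_dropLast]
  obtain ⟨ℓ₁, ℓ₂, w₁, w₂, h₁, h₂, rfl, hmod⟩ :=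
    exists_of_csr_eq hlam hSC hZ₀ hz (show 0 < g by omega) hw
  have hthr : Through A Z₀.dropLast.toFinset i j (ℓ₁ + ℓ₂) (w₁ + w₂) :=
    ⟨z, (hzZ z).2 hz, _, _, _, _, h₁, h₂, rfl, rfl⟩
  obtain ⟨x, c, f, L, hcon, rfl, rfl, c0, hL, hmax⟩ :=
    hthr.exists_config hlam (show 0 < g by omega) hmod
  refine ⟨x, c, f, L, hcon, ?_, c0, fun ℓ w h hm => hmax ℓ w h (hm.trans hL)⟩
  have hltL : T1 A - 1 < L := by
    by_contra! hle
    obtain ⟨K, hK⟩ := (Nat.modEq_iff_dvd' hle).1 hL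
    have hself := hlen ▸ hZ₀.reach_self hlam ((hzZ _).1 hcon.mem)
    have hr := ((hcon.traj.seg (Nat.zero_le f) hcon.le).trans (hself.repeat_closed K)).trans
      (hcon.traj.seg hcon.le le_rfl)
    have hfL := hcon.le
    have := hlt _ (hr.cast (show _ = T1 A - 1 by rw [← hK]; omega) rfl)
    have := hmax _ _ hthr hmod
    linarith
  have := Nat.le_of_dvd (by omega) ((Nat.modEq_iff_dvd' hltL.le).1 hL.symm)
  rw [Nat.mul_add]
  omega

end

end

section

variable {n : ℕ} {A : Mat n}

theorem IsCycle.mem_of_len_eq {R : Fin n → Fin n → Prop} {W : List (Fin n)} (h : IsCycle R W)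
    (hlen : len W = n) (v : Fin n) : v ∈ W := by
  rw [← h.mem_dropLast, ← List.mem_toFinset]
  rw [(Finset.card_eq_iff_eq_univ _).1 (h.card_toFinset.trans (by simpa using hlen))]
  exact Finset.mem_univ v

namespace Config

variable {Z : Finset (Fin n)} {g : ℕ} {x y : ℕ → Fin n} {c d : ℕ → ℝ} {f L : ℕ}

theorem splice (h : Config A Z g x c f L) (hfL : f + n ≤ L) (hx : x (f + n) = x f)
    (hn : 0 < n) (hy : Traj A y d n) (hy0 : y 0 = x f) (hyn : y n = x f) (hd0 : d 0 = 0)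
    (hdn : d n = c (f + n) - c f) :
    Config A Z g (fun k => if k < f then x k else if k < f + n then y (k - f) else x k)
      (fun k => if k < f then c k else if k < f + n then c f + d (k - f) else c k) f L := by
  have e0 : (if 0 < f then x 0 else if 0 < f + n then y (0 - f) else x 0) = x 0 := by
    rcases Nat.eq_zero_or_pos f with rfl | hf
    · simp [hn, hy0]
    · simp [hf]
  have eL : (if L < f then x L else if L < f + n then y (L - f) else x L) = x L := by
    rw [if_neg (by omega), if_neg (by omega)]
  have ec0 : (if 0 < f then c 0 else if 0 < f + n then c f + d (0 - f) else c 0) = c 0 := by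
    rcases Nat.eq_zero_or_pos f with rfl | hf
    · simp [hn, hd0]
    · simp [hf]
  have ecL : (if L < f then c L else if L < f + n then c f + d (L - f) else c L) = c L := by
    rw [if_neg (by omega), if_neg (by omega)]
  refine ⟨?_, h.le, by simpa [hn, hy0] using h.mem, h.closed, ?_, ?_⟩
  · intro k hk
    by_cases h₁ : k < f
    · simp only [h₁, if_true]
      by_cases h₂ : k + 1 < f
      · simp only [h₂, if_true, h.traj k hk]
      · obtain rfl : f = k + 1 := by omega
        simp only [lt_irrefl, if_false, show k + 1 < k + 1 + n by omega, if_true, Nat.sub_self,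
          hy0, hd0, add_zero, h.traj k hk]
    · by_cases h₂ : k < f + n
      · have hyk := hy (k - f) (by omega)
        rw [show k - f + 1 = k + 1 - f by omega] at hyk
        simp only [h₁, h₂, if_false, if_true, show ¬ k + 1 < f by omega]
        by_cases h₃ : k + 1 < f + n
        · simp only [h₃, if_true, hyk]
          congr 1
          ring
        · have hk' : k + 1 = f + n := by omega
          rw [if_neg h₃, if_neg h₃, hk', hx, ← hyn]
          rw [hk', Nat.add_sub_cancel_left] at hyk
          rw [hyk, hdn]
          congr 1
          ring
      · simp only [h₁, h₂, if_false, show ¬ k + 1 < f by omega, show ¬ k + 1 < f + n by omega,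
          h.traj k hk]
  · simp only [e0, eL, ec0, ecL]
    exact h.minLen
  · simp only [e0, eL, ec0, ecL]
    exact h.minFirst

/-- The segment of length `n` starting at the first visit of `Z` is the unique Hamiltonian cycle of
maximal weight. -/
theorem exists_unique_hamiltonian (h : Config A Z g x c f L) (hg : 2 ≤ g) (hZ : Z.card = g)
    (hL : g * n + n ≤ L + 1 + g) (hne : ¬(n = 2 ∧ g = 2))
    (hcyc : ∀ z ∈ Z, ∀ u ∈ Z, ∃ ℓ₁ ℓ₂ a, ℓ₁ + ℓ₂ = g ∧ Reach A z u ℓ₁ a ∧ Reach A u z ℓ₂ (-a))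
    (hc0 : c 0 = 0)
    (hmax : ∀ ℓ w, Through A Z (x 0) (x L) ℓ w → ℓ ≡ L [MOD g] → w ≤ c L) :
    ∃ H, IsCycle (arc A) H ∧ len H = n ∧
      (∀ W, IsCycle (arc A) W → len W = n → weight A W ≤ weight A H) ∧
      (∀ W, IsCycle (arc A) W → len W = n →
        (∀ V, IsCycle (arc A) V → len V = n → weight A V ≤ weight A W) →
          W.dropLast ~r H.dropLast) := by
  have hn : 0 < n := (x 0).pos
  have hlen := h.suffix_length hg hZ hL
  have h2n : 2 * n ≤ g * n := Nat.mul_le_mul_right n hg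
  have hper : x (f + n) = x f := h.periodic hg hZ hL hne hcyc le_rfl (by omega)
  have htraj : Traj A (fun k => x (f + k)) (fun k => c (f + k)) n := h.traj.shift f (by omega)
  have hH : IsCycle (arc A) ((List.range (n + 1)).map fun k => x (f + k)) := by
    refine isCycle_map_range htraj hn hper.symm fun a b hab hb he => ?_
    have := h.le_sub_of_eq hg hZ hL hne hcyc (show f ≤ f + a by omega)
      (show f + a < f + b by omega) (by omega) he
    omega
  have hle : ∀ y d, Traj A y d n → y 0 = x f → y n = x f → d 0 = 0 →
      d n ≤ c (f + n) - c f := by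
    intro y d hy hy0 hyn hd0
    have r₁ := h.traj.seg (Nat.zero_le f) h.le
    have r₂ := hy.seg (Nat.zero_le n) le_rfl
    have r₃ := h.traj.seg (show f + n ≤ L by omega) le_rfl
    rw [hy0, hyn] at r₂
    rw [hper] at r₃
    have := hmax L _ ⟨x f, h.mem, _, _, _, _, r₁, r₂.trans r₃, by omega, rfl⟩ rfl
    linarith
  refine ⟨_, hH, len_map_range _ n, fun W hW hWn => ?_, fun W hW hWn hWmax => ?_⟩
  · obtain ⟨y, d, hy, hy0, hyn, hd0, hw, -⟩ := hW.exists_traj (hW.mem_of_len_eq hWn (x f))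
    rw [hWn] at hy hyn hw
    rw [hw, weight_map_range htraj]
    exact_mod_cast hle y d hy hy0 hyn hd0
  · obtain ⟨y, d, hy, hy0, hyn, hd0, hw, hrot, -⟩ :=
      hW.exists_traj (hW.mem_of_len_eq hWn (x f))
    rw [hWn] at hy hyn hw hrot
    have hge := hWmax _ hH (len_map_range _ n)
    rw [hw, weight_map_range htraj] at hge
    have hge : c (f + n) - c f ≤ d n := by exact_mod_cast hge
    have hcon := h.splice (by omega) hper hn hy hy0 hyn hd0
      (le_antisymm (hle y d hy hy0 hyn hd0) hge)
    rw [dropLast_map_range]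
    convert hrot using 1
    refine List.map_congr_left fun m hm => ?_
    rw [List.mem_range] at hm
    have e₁ := h.periodic hg hZ hL hne hcyc (show f ≤ f + m by omega) (by omega)
    have e₂ := hcon.periodic hg hZ hL hne hcyc (show f ≤ f + m by omega) (by omega)
    simp only [show ¬ f + m + n < f by omega, show ¬ f + m + n < f + n by omega,
      show ¬ f + m < f by omega, show f + m < f + n by omega, if_true, if_false,
      Nat.add_sub_cancel_left] at e₂
    rw [← e₁, e₂]

end Config

end

section

variable {n : ℕ} {A : Mat n}

theorem weight_splice (P l Q : List (Fin n)) (h : Fin n) :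
    weight A (P ++ h :: (l ++ h :: Q)) =
      weight A (P ++ [h]) + (weight A (h :: l ++ [h]) + weight A (h :: Q)) := by
  rw [weight_append, ← weight_append (h :: l)]
  rfl

/-- A closed walk covering all nodes inside a twice optimal walk is, if it has length `n`, a
Hamiltonian cycle of maximal weight. -/
theorem TwiceOpt.hamiltonian_max {Z₀ : List (Fin n)} {i j h : Fin n} {g m : ℕ}
    {P F Q : List (Fin n)} (hopt : TwiceOpt A Z₀ i j g m (P ++ h :: (F ++ h :: Q)))
    (hZ₀ : Z₀ ≠ []) (hnd : (h :: F).Nodup) (hlen : (h :: F).length = n) :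
    IsCycle (arc A) (h :: F ++ [h]) ∧ ∀ W, IsCycle (arc A) W → len W = n →
      weight A W ≤ weight A (h :: F ++ [h]) := by
  obtain ⟨⟨⟨⟨-, hch⟩, hi, hj⟩, -, hmod⟩, hmax, -⟩ := hopt
  have hbot := (chain_iff_weight_ne_bot _).1 hch
  rw [weight_splice, ne_eq, WithBot.add_eq_bot, WithBot.add_eq_bot, not_or, not_or] at hbot
  obtain ⟨h₁, h₂, h₃⟩ := hbot
  refine ⟨⟨by simp, (chain_iff_weight_ne_bot _).2 h₂, by rw [List.getLast?_concat]; rfl, by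
    rwa [List.dropLast_concat]⟩, fun W hW hWn => ?_⟩
  obtain ⟨b, hb, hw, hl, hrot⟩ := hW.exists_rotate (hW.mem_of_len_eq hWn h)
  rw [← hw]
  have hbw : weight A (h :: b ++ [h]) ≠ ⊥ := (chain_iff_weight_ne_bot _).1 hb.2.1
  have hbl : b.length = F.length := by
    simp [len] at hl hlen hWn
    omega
  obtain ⟨z, hz⟩ := List.exists_mem_of_ne_nil _ hZ₀
  have hzb : z ∈ h :: b := hrot.mem_iff.1 (hW.mem_dropLast.2 (hW.mem_of_len_eq hWn z))
  have hV := hmax (P ++ h :: (b ++ h :: Q)) ⟨⟨⟨by simp, ?_⟩, ?_, ?_⟩, ⟨z, ?_, hz⟩, ?_⟩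
  · rw [weight_splice, weight_splice] at hV
    obtain ⟨p, hp⟩ := WithBot.ne_bot_iff_exists.1 h₁
    obtain ⟨q, hq⟩ := WithBot.ne_bot_iff_exists.1 h₂
    obtain ⟨r, hr⟩ := WithBot.ne_bot_iff_exists.1 h₃
    obtain ⟨s, hs⟩ := WithBot.ne_bot_iff_exists.1 hbw
    rw [← hp, ← hq, ← hr, ← hs] at hV
    rw [← hq, ← hs]
    have hV : p + (s + r) ≤ p + (q + r) := by exact_mod_cast hV
    exact_mod_cast (by linarith : s ≤ q)
  · refine (chain_iff_weight_ne_bot _).2 ?_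
    rw [weight_splice, ne_eq, WithBot.add_eq_bot, WithBot.add_eq_bot, not_or, not_or]
    exact ⟨h₁, hbw, h₃⟩
  · rw [← hi]
    cases P <;> rfl
  · rw [← hj]
    simp [List.getLast?_append, List.getLast?_cons]
  · rw [List.mem_append, ← List.cons_append, List.mem_append]
    exact .inr (.inl hzb)
  · rw [← hmod]
    simp [len, hbl]

theorem wInteresting_eq {n g : ℕ} (hn : 0 < n) (hg : 2 ≤ g) : ∃ P h F Q,
    List.finRange n = h :: F ∧ wInteresting n g = P ++ h :: (F ++ h :: Q) ∧
      stdCyc n n = h :: F ++ [h] := by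
  obtain ⟨k, rfl⟩ : ∃ k, g = k + 2 := ⟨g - 2, by omega⟩
  obtain ⟨m, rfl⟩ : ∃ m, n = m + 1 := ⟨n - 1, by omega⟩
  obtain ⟨h, F, hF⟩ : ∃ h F, List.finRange (m + 1) = h :: F :=
    ⟨_, _, List.finRange_succ⟩
  refine ⟨(List.finRange (m + 1)).drop (k + 2), h, F,
    F ++ (List.replicate k (List.finRange (m + 1))).flatten, hF, ?_, ?_⟩
  · rw [wInteresting, List.replicate_succ, List.replicate_succ, List.flatten_cons,
      List.flatten_cons, hF]
    simp
  · rw [stdCyc, List.take_of_length_le (by simp), hF]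
    rfl

end

/-- Corollary 4.10 (with Remark 4.11): under the stated hypotheses, `D(A)` has a unique
Hamiltonian cycle of maximal weight up to choice of its first node; moreover, under the
renumbering of the nodes for which the interesting walk equals `(g+1)⋯n(1⋯n)^g`, this
Hamiltonian cycle is `1 2 ⋯ n 1`. -/
theorem unique_max_hamiltonian {n : ℕ} (A : Mat n) (g : ℕ)
    (hgdef : g = maxGirth (critArc A)) (hg : 2 ≤ g) (hlam : lam A = 0)
    (hT : T1 A = DM g n) (hne : ¬(n = 2 ∧ g = 2))
    (Z0 : List (Fin n)) (hZ0 : IsCritCycle A Z0) (hZ0len : len Z0 = g)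
    (hSC : ∀ i j, critNode A i → critNode A j → reach (critArc A) i j)
    (huniq : ∀ Z, IsCritCycle A Z → len Z = g → Z.dropLast ~r Z0.dropLast) :
    (∃ H, IsCycle (arc A) H ∧ len H = n ∧
      (∀ W, IsCycle (arc A) W → len W = n → weight A W ≤ weight A H) ∧
      (∀ W, IsCycle (arc A) W → len W = n →
        (∀ V, IsCycle (arc A) V → len V = n → weight A V ≤ weight A W) →
          W.dropLast ~r H.dropLast)) ∧
    (∀ (σ : Equiv.Perm (Fin n)) i j W0, Interesting A g Z0 i j W0 →
      W0 = (wInteresting n g).map σ →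
        IsCycle (arc A) ((stdCyc n n).map σ) ∧ len ((stdCyc n n).map σ) = n ∧
        (∀ W, IsCycle (arc A) W → len W = n →
          weight A W ≤ weight A ((stdCyc n n).map σ))) := by
  have hmem : ∀ v, v ∈ Z0.dropLast.toFinset ↔ v ∈ Z0 := fun v => by
    rw [List.mem_toFinset, hZ0.1.mem_dropLast]
  obtain ⟨x, c, f, L, hcon, hL, hc0, hmax⟩ := exists_config hg hlam hT hZ0 hZ0len hSC
  refine ⟨hcon.exists_unique_hamiltonian hg (hZ0.1.card_toFinset.trans hZ0len) hL hne
    (fun z hz u hu => hZ0len ▸ hZ0.exists_reach hlam ((hmem z).1 hz) ((hmem u).1 hu)) hc0 hmax,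
    ?_⟩
  rintro σ i j W0 ⟨hopt, -⟩ rfl
  obtain ⟨P, h, F, Q, hF, hW0, hstd⟩ := wInteresting_eq i.pos hg
  rw [hW0, List.map_append, List.map_cons, List.map_append, List.map_cons] at hopt
  have hnd : (σ h :: F.map σ).Nodup := by
    rw [← List.map_cons, ← hF]
    exact (List.nodup_finRange n).map σ.injective
  have hlen : (σ h :: F.map σ).length = n := by
    rw [← List.map_cons, ← hF, List.length_map, List.length_finRange]
  have hZ0ne : Z0 ≠ [] := by
    rintro rfl
    exact absurd hZ0.1.1 (by simp)
  have := hopt.hamiltonian_max hZ0ne hnd hlen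
  rw [hstd, List.map_append, List.map_cons]
  exact ⟨this.1, by simpa [len] using hlen, this.2⟩

end MaxPlus
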